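/- arXiv:2410.22676 — 2 statements merged into one kernel-verified Lean document; each statement's English description precedes it below -/
import Mathlib

section
/- Let n > 2k, k ≥ 5, and let F ⊆ ([n] choose k) be an intersecting family that is not contained in any star nor in any copy of the Hilton–Milner family M_{k+1}. Then |F| ≤ C(n-1,k-1) − C(n-k-1,k-1) − C(n-k-2,k-2) + 2, with equality iff F is isomorphic to M_{k,2}. -/
open Finset

/-- The family `M_i` on ground set `[n] = {1,…,n}`. -/
def familyM (n k i : ℕ) : Finset (Finset ℕ) :=
  ((Finset.Icc 1 n).powersetCard k).filter
    (fun F => (1 ∈ F ∧ (F ∩ Finset.Icc 2 i).Nonempty) ∨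
              (1 ∉ F ∧ Finset.Icc 2 i ⊆ F))

/-- The family `M_{k,j}` on ground set `[n] = {1,…,n}`. -/
def familyMkj (n k j : ℕ) : Finset (Finset ℕ) :=
  ((Finset.Icc 1 n).powersetCard k).filter
    (fun F => (1 ∈ F ∧ (F ∩ Finset.Icc 2 k).Nonempty) ∨
              (1 ∈ F ∧ F ∩ Finset.Icc 2 k = ∅ ∧ Finset.Icc (k + 1) (k + j) ⊆ F) ∨
              (1 ∉ F ∧ Finset.Icc 2 k ⊆ F ∧ (F ∩ Finset.Icc (k + 1) (k + j)).card = 1))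

namespace IntersectingFamily

/-- Every member of `A` meets every member of `B`. -/
def Cross (A B : Finset (Finset ℕ)) : Prop :=
  ∀ X ∈ A, ∀ Y ∈ B, ¬ Disjoint X Y

/-- The set `X` with `j` replaced by `i`. -/
def move (i j : ℕ) (X : Finset ℕ) : Finset ℕ := insert i (X.erase j)

/-- The family is closed under replacing an element by a smaller element of `V`. -/
def IsShifted (V : Finset ℕ) (A : Finset (Finset ℕ)) : Prop :=
  ∀ X ∈ A, ∀ i ∈ V, ∀ j ∈ X, i < j → i ∉ X → move i j X ∈ A

lemma choose_lt_choose_of_lt {m n k : ℕ} (hk : 0 < k) (hkn : k ≤ n) (hmn : m < n) :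
    m.choose k < n.choose k := by
  obtain ⟨k, rfl⟩ := Nat.exists_eq_succ_of_ne_zero hk.ne'
  obtain ⟨n, rfl⟩ := Nat.exists_eq_succ_of_ne_zero (by omega : n ≠ 0)
  have h1 : m.choose (k + 1) ≤ n.choose (k + 1) := Nat.choose_le_choose _ (by omega)
  have h2 : 0 < n.choose k := Nat.choose_pos (by omega)
  rw [Nat.choose_succ_succ']
  exact lt_of_le_of_lt h1 (by omega)

lemma Cross.symm {A B : Finset (Finset ℕ)} (h : Cross A B) : Cross B A :=
  fun X hX Y hY hd => h Y hY X hX hd.symm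

lemma Cross.member_nonMember {A B : Finset (Finset ℕ)} (h : Cross A B) (e : ℕ) :
    Cross (A.memberSubfamily e) (B.nonMemberSubfamily e) := by
  intro X hX Y hY hd
  rw [mem_memberSubfamily] at hX
  rw [mem_nonMemberSubfamily] at hY
  exact h _ hX.1 Y hY.1 (disjoint_insert_left.2 ⟨hY.2, hd⟩)

lemma member_subset {V : Finset ℕ} {A : Finset (Finset ℕ)} {a : ℕ}
    (h : A ⊆ V.powersetCard a) (e : ℕ) :
    A.memberSubfamily e ⊆ (V.erase e).powersetCard (a - 1) := by
  intro X hX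
  rw [mem_memberSubfamily] at hX
  have h1 := mem_powersetCard.1 (h hX.1)
  rw [card_insert_of_notMem hX.2] at h1
  rw [mem_powersetCard]
  refine ⟨fun x hx => mem_erase.2 ⟨?_, h1.1 (mem_insert_of_mem hx)⟩, by omega⟩
  rintro rfl
  exact hX.2 hx

lemma nonMember_subset {V : Finset ℕ} {A : Finset (Finset ℕ)} {a : ℕ}
    (h : A ⊆ V.powersetCard a) (e : ℕ) :
    A.nonMemberSubfamily e ⊆ (V.erase e).powersetCard a := by
  intro X hX
  rw [mem_nonMemberSubfamily] at hX
  have h1 := mem_powersetCard.1 (h hX.1)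
  rw [mem_powersetCard]
  refine ⟨fun x hx => mem_erase.2 ⟨?_, h1.1 hx⟩, h1.2⟩
  rintro rfl
  exact hX.2 hx

/-- Double counting of disjoint pairs. -/
lemma card_mul_choose_le {V : Finset ℕ} {A B : Finset (Finset ℕ)} {a b : ℕ}
    (hB : B ⊆ V.powersetCard b) (h : Cross A B) :
    #B * (#V - b).choose a ≤ #(V.powersetCard a \ A) * (#V - a).choose b := by
  refine card_mul_le_card_mul (fun Y X => Disjoint Y X) ?_ ?_
  · intro Y hY
    have hY' := mem_powersetCard.1 (hB hY)
    rw [← hY'.2, ← card_sdiff_of_subset hY'.1, ← card_powersetCard]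
    refine card_le_card fun X hX => ?_
    rw [mem_powersetCard, subset_sdiff] at hX
    rw [mem_bipartiteAbove, mem_sdiff, mem_powersetCard]
    exact ⟨⟨⟨hX.1.1, hX.2⟩, fun hXA => h X hXA Y hY hX.1.2⟩, hX.1.2.symm⟩
  · intro X hX
    have hX' := mem_powersetCard.1 (mem_sdiff.1 hX).1
    rw [← hX'.2, ← card_sdiff_of_subset hX'.1, ← card_powersetCard]
    refine card_le_card fun Y hY => ?_
    rw [mem_bipartiteBelow] at hY
    have hY' := mem_powersetCard.1 (hB hY.1)
    rw [mem_powersetCard, subset_sdiff]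
    exact ⟨⟨hY'.1, hY.2⟩, hY'.2⟩

lemma card_sdiff_add {V : Finset ℕ} {A : Finset (Finset ℕ)} {a : ℕ}
    (hA : A ⊆ V.powersetCard a) : #(V.powersetCard a \ A) + #A = (#V).choose a := by
  rw [card_sdiff_add_card_eq_card hA, card_powersetCard]

lemma Cross.card_add_card_le {V : Finset ℕ} {A B : Finset (Finset ℕ)} {a b : ℕ}
    (hA : A ⊆ V.powersetCard a) (hB : B ⊆ V.powersetCard b) (h : Cross A B)
    (hba : b ≤ a) (hV : a + b ≤ #V) : #A + #B ≤ (#V).choose a := by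
  have h1 := card_mul_choose_le (a := a) hB h
  have h2 := card_sdiff_add hA
  have h3 : (#V - a).choose b ≤ (#V - b).choose a := by
    rw [← Nat.choose_symm (show b ≤ #V - a by omega), ← Nat.choose_symm (show a ≤ #V - b by omega),
      Nat.sub_right_comm]
    exact Nat.choose_le_choose _ (by omega)
  have h4 : 0 < (#V - b).choose a := Nat.choose_pos (by omega)
  have h5 := Nat.le_of_mul_le_mul_right (h1.trans (Nat.mul_le_mul_left _ h3)) h4
  omega

lemma Cross.card_add_card_lt {V : Finset ℕ} {A B : Finset (Finset ℕ)} {a b : ℕ}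
    (hA : A ⊆ V.powersetCard a) (hB : B ⊆ V.powersetCard b) (h : Cross A B)
    (hba : b < a) (hV : a + b < #V) (hne : B.Nonempty) : #A + #B < (#V).choose a := by
  have h1 := card_mul_choose_le (a := a) hB h
  have h2 := card_sdiff_add hA
  have h3 : (#V - a).choose b < (#V - b).choose a := by
    rw [← Nat.choose_symm (show b ≤ #V - a by omega), ← Nat.choose_symm (show a ≤ #V - b by omega),
      Nat.sub_right_comm]
    exact choose_lt_choose_of_lt (by omega) (by omega) (by omega)
  have h4 : 0 < #B * (#V - b).choose a :=
    Nat.mul_pos hne.card_pos (Nat.choose_pos (by omega))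
  have h6 : 0 < #(V.powersetCard a \ A) := by
    rcases Nat.eq_zero_or_pos #(V.powersetCard a \ A) with h0 | h0
    · rw [h0] at h1; omega
    · exact h0
  have h5 := Nat.lt_of_mul_lt_mul_right (h1.trans_lt (Nat.mul_lt_mul_of_pos_left h3 h6))
  omega

/-- Members of `C` all meet `Z`. -/
lemma card_add_choose_le {V Z : Finset ℕ} {C : Finset (Finset ℕ)} {c : ℕ}
    (hC : C ⊆ V.powersetCard c) (hZ : Z ⊆ V) (h : ∀ X ∈ C, ¬ Disjoint X Z) :
    #C + (#V - #Z).choose c ≤ (#V).choose c := by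
  rw [← card_sdiff_of_subset hZ, ← card_powersetCard, ← card_powersetCard, ← card_union_of_disjoint]
  · refine card_le_card (union_subset hC (powersetCard_mono sdiff_subset))
  · rw [disjoint_left]
    intro X hX hX'
    rw [mem_powersetCard, subset_sdiff] at hX'
    exact h X hX hX'.1.2

/-- Two families with the reflection property: the larger sets climb to height `h`. -/
lemma card_add_card_le_of_walk (V : Finset ℕ) : ∀ (b h : ℕ) (C D : Finset (Finset ℕ)),
    C ⊆ V.powersetCard b → D ⊆ V.powersetCard (b + h) → Cross D C → 2 * b + h ≤ #V →
    (0 < h → ∀ X ∈ D, ∃ p, h + #{v ∈ V | v ≤ p} ≤ 2 * #{v ∈ X | v ≤ p}) →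
    #C + #D ≤ (#V).choose b := by
  induction V using Finset.induction_on_min with
  | empty =>
    intro b h C D hC hD hx hV _
    have hb : b = 0 := by simp at hV; omega
    have hh : h = 0 := by simp at hV; omega
    subst hb hh
    exact Cross.card_add_card_le hC hD hx.symm le_rfl (by simp)
  | insert e V he ih =>
    intro b h C D hC hD hx hV hw
    have heV : e ∉ V := fun h => lt_irrefl _ (he e h)
    rcases Nat.eq_zero_or_pos h with rfl | hpos
    · exact Cross.card_add_card_le hC hD hx.symm le_rfl (by omega)
    obtain ⟨h, rfl⟩ := Nat.exists_eq_succ_of_ne_zero hpos.ne'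
    rw [card_insert_of_notMem heV] at hV ⊢
    have hw := hw hpos
    have hC0 := nonMember_subset hC e
    have hC1 := member_subset hC e
    have hD0 := nonMember_subset hD e
    have hD1 := member_subset hD e
    rw [erase_insert heV] at hC0 hC1 hD0 hD1
    have key : ∀ X ∈ D, ∃ p, e ≤ p ∧ h + 1 + (1 + #{v ∈ V | v ≤ p}) ≤ 2 * #{v ∈ X | v ≤ p} := by
      intro X hX
      obtain ⟨p, hp⟩ := hw X hX
      have hXV := (mem_powersetCard.1 (hD hX)).1
      have hep : e ≤ p := by
        have : 0 < #{v ∈ X | v ≤ p} := by omega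
        obtain ⟨x, hx⟩ := card_pos.1 this
        rw [mem_filter] at hx
        rcases mem_insert.1 (hXV hx.1) with rfl | h'
        · exact hx.2
        · exact (he x h').le.trans hx.2
      refine ⟨p, hep, ?_⟩
      rw [filter_insert, if_pos hep, card_insert_of_notMem (by simp [heV])] at hp
      omega
    have i1 : #(C.nonMemberSubfamily e) + #(D.memberSubfamily e) ≤ (#V).choose b := by
      refine ih b h _ _ hC0 hD1 (hx.member_nonMember e) (by omega) ?_
      intro _ X hX
      rw [mem_memberSubfamily] at hX
      obtain ⟨p, hep, hp⟩ := key _ hX.1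
      refine ⟨p, ?_⟩
      rw [filter_insert, if_pos hep, card_insert_of_notMem (by simp [hX.2])] at hp
      omega
    have k0 : ∀ X ∈ D.nonMemberSubfamily e, ∃ p,
        h + 1 + 1 + #{v ∈ V | v ≤ p} ≤ 2 * #{v ∈ X | v ≤ p} := by
      intro X hX
      obtain ⟨p, hep, hp⟩ := key _ (mem_nonMemberSubfamily.1 hX).1
      exact ⟨p, by omega⟩
    have hc := card_memberSubfamily_add_card_nonMemberSubfamily e C
    have hd := card_memberSubfamily_add_card_nonMemberSubfamily e D
    rcases b with _ | b
    · have h0 : D.nonMemberSubfamily e = ∅ := by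
        rw [eq_empty_iff_forall_notMem]
        intro X hX
        obtain ⟨p, hp⟩ := k0 X hX
        have hX' := mem_powersetCard.1 (hD0 hX)
        have h1 : #{v ∈ X | v ≤ p} ≤ #X := card_filter_le _ _
        have h2 : #{v ∈ X | v ≤ p} ≤ #{v ∈ V | v ≤ p} := card_le_card (filter_subset_filter _ hX'.1)
        omega
      have h1 : C.memberSubfamily e = ∅ := by
        rw [eq_empty_iff_forall_notMem]
        intro X hX
        have := (mem_powersetCard.1 (hC (mem_memberSubfamily.1 hX).1)).2
        simp at this
      rw [h0, card_empty] at hd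
      rw [h1, card_empty] at hc
      simp at i1 ⊢
      omega
    · have i2 : #(C.memberSubfamily e) + #(D.nonMemberSubfamily e) ≤ (#V).choose b := by
        refine ih b (h + 2) _ _ (by simpa using hC1) (by convert hD0 using 2; omega)
          (hx.symm.member_nonMember e).symm (by omega) (fun _ => k0)
      rw [Nat.choose_succ_succ']
      omega

lemma card_filter_move_of_le {X : Finset ℕ} {i j p : ℕ} (hj : j ∈ X) (hi : i ∉ X) (hjp : j ≤ p)
    (hip : i ≤ p) : #{v ∈ move i j X | v ≤ p} = #{v ∈ X | v ≤ p} := by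
  rw [move, filter_insert, if_pos hip, card_insert_of_notMem (by simp [hi]), filter_erase,
    card_erase_of_mem (by simp [hj, hjp])]
  have : 0 < #{v ∈ X | v ≤ p} := card_pos.2 ⟨j, by simp [hj, hjp]⟩
  omega

/-- Members of two shifted cross-intersecting families overlap on an initial segment. -/
lemma exists_card_lt {V : Finset ℕ} {A B : Finset (Finset ℕ)} (hA : IsShifted V A)
    (h : Cross A B) {Y : Finset ℕ} (hY : Y ∈ B) (hYV : Y ⊆ V) :
    ∀ (N : ℕ), ∀ X ∈ A, X ⊆ V → #(X ∩ Y) = N →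
      ∃ p, #{v ∈ V | v ≤ p} < #{v ∈ X | v ≤ p} + #{v ∈ Y | v ≤ p} := by
  intro N
  induction N with
  | zero =>
    intro X hX _ h0
    exact absurd (disjoint_iff_inter_eq_empty.2 (card_eq_zero.1 h0)) (h X hX Y hY)
  | succ N ih =>
    intro X hX hXV hN
    by_contra! H
    have hne : (X ∩ Y).Nonempty := card_pos.1 (by omega)
    obtain ⟨e, heXY, hmin⟩ : ∃ e ∈ X ∩ Y, ∀ x ∈ X ∩ Y, e ≤ x :=
      ⟨_, min'_mem _ hne, fun x hx => min'_le _ _ hx⟩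
    rw [mem_inter] at heXY
    obtain ⟨c, hcV, hce, hcX, hcY⟩ : ∃ c ∈ V, c < e ∧ c ∉ X ∧ c ∉ Y := by
      by_contra! hc
      have h1 : ({v ∈ V | v ≤ e} : Finset ℕ) ⊆ {v ∈ X | v ≤ e} ∪ {v ∈ Y | v ≤ e} := by
        intro v hv
        rw [mem_filter] at hv
        rw [mem_union, mem_filter, mem_filter]
        by_cases hvX : v ∈ X
        · exact Or.inl ⟨hvX, hv.2⟩
        · rcases hv.2.lt_or_eq with h' | rfl
          · exact Or.inr ⟨hc v hv.1 h' hvX, hv.2⟩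
          · exact absurd heXY.1 hvX
      have h2 := card_le_card h1
      have h3 := card_union_add_card_inter ({v ∈ X | v ≤ e}) ({v ∈ Y | v ≤ e})
      have h4 : 0 < #(({v ∈ X | v ≤ e} : Finset ℕ) ∩ {v ∈ Y | v ≤ e}) :=
        card_pos.2 ⟨e, by simp [heXY.1, heXY.2]⟩
      have := H e
      omega
    have hX' := hA X hX c hcV e heXY.1 hce hcX
    have hi : move c e X ∩ Y = (X ∩ Y).erase e := by
      rw [move, insert_inter_of_notMem hcY, erase_inter]
    obtain ⟨p, hp⟩ := ih _ hX' (insert_subset hcV ((erase_subset _ _).trans hXV)) (by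
      rw [hi, card_erase_of_mem (mem_inter.2 heXY)]; omega)
    have Hp := H p
    rcases lt_or_ge p e with hpe | hpe
    · rcases lt_or_ge p c with hpc | hpc
      · have : ({v ∈ move c e X | v ≤ p} : Finset ℕ) = {v ∈ X | v ≤ p} := by
          rw [move, filter_insert, if_neg (by omega), filter_erase, erase_eq_of_notMem]
          simp; omega
        rw [this] at hp
        omega
      · have h1 : #{v ∈ move c e X | v ≤ p} ≤ #{v ∈ X | v ≤ p} + 1 := by
          rw [move, filter_insert, if_pos hpc, filter_erase, erase_eq_of_notMem (by simp; omega)]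
          exact card_insert_le _ _
        have h2 : insert c (({v ∈ X | v ≤ p} : Finset ℕ) ∪ {v ∈ Y | v ≤ p}) ⊆ {v ∈ V | v ≤ p} := by
          refine insert_subset (by simp [hcV, hpc]) (union_subset ?_ ?_)
          · exact filter_subset_filter _ hXV
          · exact filter_subset_filter _ hYV
        have h3 := card_le_card h2
        rw [card_insert_of_notMem (by simp [hcX, hcY]), card_union_of_disjoint] at h3
        · omega
        · rw [disjoint_left]
          intro v hv hv'
          rw [mem_filter] at hv hv'
          have := hmin v (mem_inter.2 ⟨hv.1, hv'.1⟩)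
          omega
    · rw [card_filter_move_of_le heXY.1 hcX hpe (by omega)] at hp
      omega

lemma exists_min {V : Finset ℕ} (h : V.Nonempty) : ∃ e ∈ V, ∀ x ∈ V, e ≤ x :=
  ⟨_, min'_mem _ h, fun _ hx => min'_le _ _ hx⟩

lemma IsShifted.member {V : Finset ℕ} {B : Finset (Finset ℕ)} (h : IsShifted V B) (e : ℕ) :
    IsShifted (V.erase e) (B.memberSubfamily e) := by
  intro X hX i hi j hj hij hiX
  rw [mem_memberSubfamily] at hX ⊢
  rw [mem_erase] at hi
  have hje : j ≠ e := fun h => hX.2 (h ▸ hj)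
  have := h _ hX.1 i hi.2 j (mem_insert_of_mem hj) hij (by simp [hi.1, hiX])
  refine ⟨?_, by simp [move, hX.2, hi.1.symm]⟩
  convert this using 1
  rw [move, move, erase_insert_of_ne hje.symm, insert_comm]

lemma IsShifted.le_card_member {V : Finset ℕ} {B : Finset (Finset ℕ)} {e b : ℕ}
    (h : IsShifted V B) (hB : B ⊆ V.powersetCard b) (he : e ∈ V) (hmin : ∀ x ∈ V, e ≤ x)
    (hne : (B.nonMemberSubfamily e).Nonempty) : b ≤ #(B.memberSubfamily e) := by
  obtain ⟨Y, hY⟩ := hne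
  rw [mem_nonMemberSubfamily] at hY
  have hY' := mem_powersetCard.1 (hB hY.1)
  rw [← hY'.2]
  refine card_le_card_of_injOn (fun y => Y.erase y) ?_ ?_
  · intro y hy
    rw [mem_coe, mem_memberSubfamily]
    have hye : e ≠ y := fun h => hY.2 (h ▸ hy)
    refine ⟨h Y hY.1 e he y hy (lt_of_le_of_ne (hmin y (hY'.1 hy)) hye) hY.2, ?_⟩
    exact fun h => hY.2 (mem_of_mem_erase h)
  · intro y hy z _ hyz
    exact erase_injOn Y hy ‹_› hyz

lemma IsShifted.two_le_card_member {V : Finset ℕ} {B : Finset (Finset ℕ)} {e b : ℕ}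
    (h : IsShifted V B) (hB : B ⊆ V.powersetCard b) (he : e ∈ V) (hmin : ∀ x ∈ V, e ≤ x)
    (hb : 2 ≤ b) (h2 : 2 ≤ #B) : 2 ≤ #(B.memberSubfamily e) := by
  rcases (B.nonMemberSubfamily e).eq_empty_or_nonempty with h0 | h0
  · have := card_memberSubfamily_add_card_nonMemberSubfamily e B
    rw [h0, card_empty] at this
    omega
  · exact hb.trans (h.le_card_member hB he hmin h0)

lemma card_le_choose_of_subset {V T : Finset ℕ} {A : Finset (Finset ℕ)} {a : ℕ}
    (hA : A ⊆ V.powersetCard a) (hT : T ⊆ V) (h : ∀ X ∈ A, T ⊆ X) :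
    #A ≤ (#V - #T).choose (a - #T) := by
  rw [← card_sdiff_of_subset hT, ← card_powersetCard]
  refine card_le_card_of_injOn (fun X => X \ T) ?_ ?_
  · intro X hX
    have hX' := mem_powersetCard.1 (hA hX)
    rw [mem_coe, mem_powersetCard, card_sdiff_of_subset (h X hX), hX'.2]
    exact ⟨sdiff_subset_sdiff hX'.1 le_rfl, rfl⟩
  · intro X hX Y hY hXY
    rw [← sdiff_union_of_subset (h X hX), ← sdiff_union_of_subset (h Y hY)]
    exact congrArg (· ∪ T) hXY

lemma lt_choose {M r : ℕ} (hr : 2 ≤ r) (hM : r + 2 ≤ M) : M < M.choose r := by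
  induction M, hM using Nat.le_induction with
  | base =>
    rw [← Nat.choose_symm (by omega), show r + 2 - r = 1 + 1 by omega,
      Nat.choose_succ_succ' (r + 1),
      Nat.choose_one_right, Nat.choose_succ_succ' r, Nat.choose_one_right]
    have : 0 < r.choose 2 := Nat.choose_pos hr
    omega
  | succ M hM ih =>
    obtain ⟨r, rfl⟩ := Nat.exists_eq_succ_of_ne_zero (by omega : r ≠ 0)
    have : 0 < M.choose r := Nat.choose_pos (by omega)
    rw [Nat.choose_succ_succ']
    have : (M.choose (r + 1)) = M.choose r.succ := rfl
    omega

lemma card_le_of_singletons {V : Finset ℕ} {A B : Finset (Finset ℕ)} {a : ℕ} (ha : 4 ≤ a)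
    (hV : a + 2 ≤ #V) (hA : A ⊆ V.powersetCard a) (hB : B ⊆ V.powersetCard 1) (h : Cross A B)
    (h2 : 2 ≤ #B) :
    #A + #B + (#V - 1).choose a + (#V - 2).choose (a - 1) ≤ (#V).choose a + 2 ∧
    (3 ≤ #B → #A + #B + (#V - 1).choose a + (#V - 2).choose (a - 1) < (#V).choose a + 2) := by
  obtain ⟨S, hSV, hSB, hSA⟩ : ∃ S ⊆ V, #S = #B ∧ ∀ X ∈ A, S ⊆ X := by
    refine ⟨{x ∈ V | {x} ∈ B}, filter_subset _ _, ?_, ?_⟩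
    · rw [← card_image_of_injective _ (singleton_injective (α := ℕ))]
      congr 1
      ext Y
      simp only [mem_image, mem_filter]
      constructor
      · rintro ⟨x, ⟨_, hx⟩, rfl⟩; exact hx
      · intro hY
        have hY' := mem_powersetCard.1 (hB hY)
        obtain ⟨x, rfl⟩ := card_eq_one.1 hY'.2
        exact ⟨x, ⟨singleton_subset_iff.1 hY'.1, hY⟩, rfl⟩
    · intro X hX x hx
      have := h X hX _ (mem_filter.1 hx).2
      rwa [disjoint_singleton_right, not_not] at this
  obtain ⟨a, rfl⟩ := Nat.exists_eq_add_of_le ha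
  obtain ⟨m, hm⟩ := Nat.exists_eq_add_of_le hV
  have hm3 : #V = (m + a + 3) + 1 + 1 + 1 := by omega
  have e1 : #V - 1 = (m + a + 3) + 1 + 1 := by omega
  have e2 : #V - 2 = (m + a + 3) + 1 := by omega
  have p1 := Nat.choose_succ_succ' ((m + a + 3) + 1 + 1) (a + 3)
  have p2 := Nat.choose_succ_succ' ((m + a + 3) + 1) (a + 2)
  have p3 : (m + a + 3 + 1).choose (a + 2) =
      (m + a + 3).choose (a + 1) + (m + a + 3).choose (a + 1 + 1) :=
    Nat.choose_succ_succ' (m + a + 3) (a + 1)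
  have q1 : 4 + a = a + 3 + 1 := by omega
  have q2 : 4 + a - 1 = a + 2 + 1 := by omega
  have hlt : 3 ≤ #B →
      #A + #B + (#V - 1).choose (4 + a) + (#V - 2).choose (4 + a - 1) <
          (#V).choose (4 + a) + 2 := by
    intro h3
    rw [e1, e2, hm3, q2, q1, p1, p2]
    have hpos : a + 3 ≤ (m + a + 3).choose (a + 1 + 1) := by
      calc a + 3 = (a + 2 + 1).choose (a + 2) := by rw [Nat.choose_succ_self_right]
        _ ≤ _ := Nat.choose_le_choose _ (by omega)
    rcases A.eq_empty_or_nonempty with rfl | ⟨X, hX⟩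
    · rw [card_empty]
      have hS : #B ≤ #V := hSB ▸ card_le_card hSV
      have := lt_choose (M := m + a + 3 + 1) (r := a + 2) (by omega) (by omega)
      omega
    · have hBa : #B ≤ 4 + a := by
        rw [← hSB, ← (mem_powersetCard.1 (hA hX)).2]; exact card_le_card (hSA X hX)
      obtain ⟨T, hTS, hT3⟩ := exists_subset_card_eq (hSB ▸ h3 : 3 ≤ #S)
      have := card_le_choose_of_subset hA (hTS.trans hSV) (fun X hX => hTS.trans (hSA X hX))
      rw [hT3, hm3, show m + a + 3 + 1 + 1 + 1 - 3 = m + a + 3 by omega,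
        show 4 + a - 3 = a + 1 by omega] at this
      omega
  refine ⟨?_, hlt⟩
  rcases h2.lt_or_eq with h3 | h3
  · exact (hlt h3).le
  · have := card_le_choose_of_subset hA hSV hSA
    rw [hSB, ← h3, hm3, show m + a + 3 + 1 + 1 + 1 - 2 = m + a + 3 + 1 by omega,
        show 4 + a - 2 = a + 2 by omega] at this
    rw [e1, e2, hm3, q2, q1, p1, p2, ← h3]
    omega

/-- Splitting along the least element `e` reduces the sum bound to the two halves. -/
lemma card_le_of_lt : ∀ (b : ℕ) (V : Finset ℕ) (a : ℕ) (A B : Finset (Finset ℕ)),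
    1 ≤ b → b < a → 4 ≤ a → a + b + 1 ≤ #V → A ⊆ V.powersetCard a → B ⊆ V.powersetCard b →
    Cross A B → IsShifted V B → 2 ≤ #B →
    #A + #B + (#V - b).choose a + (#V - b - 1).choose (a - 1) ≤ (#V).choose a + 2 ∧
    (3 ≤ #B →
      #A + #B + (#V - b).choose a + (#V - b - 1).choose (a - 1) < (#V).choose a + 2) := by
  intro b
  induction b with
  | zero => intro V a A B h; omega
  | succ b ih =>
    intro V a A B _ hba ha hV hA hB h hs h2
    rcases Nat.eq_zero_or_pos b with rfl | hb
    · exact card_le_of_singletons ha (by omega) hA hB h h2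
    obtain ⟨e, he, hmin⟩ := exists_min (card_pos.1 (by omega : 0 < #V))
    have hV' : #(V.erase e) = #V - 1 := card_erase_of_mem he
    have hA1 := member_subset hA e
    have hA0 := nonMember_subset hA e
    have hB1 := member_subset hB e
    have hB0 := nonMember_subset hB e
    rw [Nat.add_sub_cancel] at hB1
    have hcA := card_memberSubfamily_add_card_nonMemberSubfamily e A
    have hcB := card_memberSubfamily_add_card_nonMemberSubfamily e B
    obtain ⟨i1, i2⟩ := ih _ a _ _ hb (by omega) ha (by omega) hA0 hB1
      (h.symm.member_nonMember e).symm (hs.member e)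
      (hs.two_le_card_member hB he hmin (by omega) h2)
    have j1 := (h.member_nonMember e).card_add_card_le hA1 hB0 (by omega) (by omega)
    have hp : (#V).choose a = (#V - 1).choose (a - 1) + (#V - 1).choose a := by
      obtain ⟨m, hm⟩ := Nat.exists_eq_succ_of_ne_zero (by omega : #V ≠ 0)
      obtain ⟨a, rfl⟩ := Nat.exists_eq_succ_of_ne_zero (by omega : a ≠ 0)
      rw [hm]
      exact Nat.choose_succ_succ' m a
    rw [hV'] at i1 i2 j1
    rw [show #V - (b + 1) = #V - 1 - b by omega, hp]
    refine ⟨by omega, fun h3 => ?_⟩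
    rcases (B.nonMemberSubfamily e).eq_empty_or_nonempty with h0 | h0
    · rw [h0, card_empty] at hcB j1
      have := i2 (by omega)
      omega
    · have hle := hs.le_card_member hB he hmin h0
      rcases Nat.lt_or_ge b 2 with hb2 | hb2
      · have := (h.member_nonMember e).card_add_card_lt hA1 hB0 (by omega) (by omega) h0
        rw [hV'] at this
        omega
      · have := i2 (by omega)
        omega

lemma card_le_of_walk {V : Finset ℕ} {l e : ℕ} {A B : Finset (Finset ℕ)} (hl : 4 ≤ l)
    (hV : 2 * l + 1 ≤ #V) (hA : A ⊆ V.powersetCard l) (hB : B ⊆ V.powersetCard l)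
    (h : Cross A B) (hs : IsShifted V B) (h2 : 2 ≤ #B) (he : e ∈ V) (hmin : ∀ x ∈ V, e ≤ x)
    (hw : ∀ X ∈ B.nonMemberSubfamily e,
      ∃ p, 1 + #{v ∈ V.erase e | v ≤ p} ≤ 2 * #{v ∈ X | v ≤ p}) :
    #A + #B + (#V - l).choose l + (#V - l - 1).choose (l - 1) ≤ (#V).choose l + 2 ∧
    (3 ≤ #B →
      #A + #B + (#V - l).choose l + (#V - l - 1).choose (l - 1) < (#V).choose l + 2) := by
  have hV' : #(V.erase e) = #V - 1 := card_erase_of_mem he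
  have hA1 := member_subset hA e
  have hA0 := nonMember_subset hA e
  have hB1 := member_subset hB e
  have hB0 := nonMember_subset hB e
  have hcA := card_memberSubfamily_add_card_nonMemberSubfamily e A
  have hcB := card_memberSubfamily_add_card_nonMemberSubfamily e B
  obtain ⟨i1, i2⟩ := card_le_of_lt (l - 1) _ l _ _ (by omega) (by omega) hl (by omega) hA0 hB1
    (h.symm.member_nonMember e).symm (hs.member e)
    (hs.two_le_card_member hB he hmin (by omega) h2)
  have j1 := card_add_card_le_of_walk _ (l - 1) 1 _ _ hA1 (by rwa [Nat.sub_add_cancel (by omega)])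
    (h.member_nonMember e).symm (by omega) (fun _ => hw)
  have hp : (#V).choose l = (#V - 1).choose (l - 1) + (#V - 1).choose l := by
    obtain ⟨m, hm⟩ := Nat.exists_eq_succ_of_ne_zero (by omega : #V ≠ 0)
    obtain ⟨a, rfl⟩ := Nat.exists_eq_succ_of_ne_zero (by omega : l ≠ 0)
    rw [hm]
    exact Nat.choose_succ_succ' m a
  rw [hV'] at i1 i2 j1
  rw [show #V - 1 - (l - 1) = #V - l by omega] at i1 i2
  rw [hp]
  refine ⟨by omega, fun h3 => ?_⟩
  have h5 : 3 ≤ #(B.memberSubfamily e) := by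
    rcases (B.nonMemberSubfamily e).eq_empty_or_nonempty with h0 | h0
    · rw [h0, card_empty] at hcB
      omega
    · have := hs.le_card_member hB he hmin h0
      omega
  have := i2 h5
  omega

lemma exists_walk {V : Finset ℕ} {l e : ℕ} {A B : Finset (Finset ℕ)}
    (hA : A ⊆ V.powersetCard l) (hB : B ⊆ V.powersetCard l)
    (h : Cross A B) (hs : IsShifted V A) (he : e ∈ V) {Y : Finset ℕ}
    (hY : Y ∈ B.nonMemberSubfamily e)
    (hw : ∀ p, 2 * #{v ∈ Y | v ≤ p} ≤ #{v ∈ V.erase e | v ≤ p}) :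
    ∀ X ∈ A.nonMemberSubfamily e,
      ∃ p, 1 + #{v ∈ V.erase e | v ≤ p} ≤ 2 * #{v ∈ X | v ≤ p} := by
  intro X hX
  rw [mem_nonMemberSubfamily] at hX hY
  obtain ⟨p, hp⟩ := exists_card_lt hs h hY.1 (mem_powersetCard.1 (hB hY.1)).1 _ X hX.1
    (mem_powersetCard.1 (hA hX.1)).1 rfl
  refine ⟨p, ?_⟩
  have h1 := hw p
  rw [filter_erase] at h1 ⊢
  have h2 := pred_card_le_card_erase (s := {v ∈ V | v ≤ p}) (a := e)
  have h3 : #({v ∈ V | v ≤ p}.erase e) ≤ #{v ∈ V | v ≤ p} := card_erase_le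
  rcases le_or_gt e p with hep | hep
  · have h4 : #({v ∈ V | v ≤ p}.erase e) = #{v ∈ V | v ≤ p} - 1 :=
      card_erase_of_mem (by simp [he, hep])
    have h5 : 0 < #{v ∈ V | v ≤ p} := card_pos.2 ⟨e, by simp [he, hep]⟩
    omega
  · omega

lemma card_le_of_isShifted {V : Finset ℕ} {l : ℕ} {A B : Finset (Finset ℕ)} (hl : 4 ≤ l)
    (hV : 2 * l + 1 ≤ #V) (hA : A ⊆ V.powersetCard l) (hB : B ⊆ V.powersetCard l)
    (h : Cross A B) (hsA : IsShifted V A) (hsB : IsShifted V B) (hA2 : 2 ≤ #A) (hB2 : 2 ≤ #B) :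
    #A + #B + (#V - l).choose l + (#V - l - 1).choose (l - 1) ≤ (#V).choose l + 2 ∧
    (3 ≤ #A → 3 ≤ #B →
      #A + #B + (#V - l).choose l + (#V - l - 1).choose (l - 1) < (#V).choose l + 2) := by
  obtain ⟨e, he, hmin⟩ := exists_min (card_pos.1 (by omega : 0 < #V))
  by_cases hw : ∀ X ∈ B.nonMemberSubfamily e,
      ∃ p, 1 + #{v ∈ V.erase e | v ≤ p} ≤ 2 * #{v ∈ X | v ≤ p}
  · obtain ⟨i1, i2⟩ := card_le_of_walk hl hV hA hB h hsB hB2 he hmin hw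
    exact ⟨i1, fun _ => i2⟩
  · push Not at hw
    obtain ⟨Y, hY, hw⟩ := hw
    obtain ⟨i1, i2⟩ := card_le_of_walk hl hV hB hA h.symm hsA hA2 he hmin
      (exists_walk hA hB h hsA he hY (fun p => by have := hw p; omega))
    rw [add_comm #A]
    exact ⟨i1, fun h3 _ => i2 h3⟩

/-- The image of a member of `A` under the shift of `A`. -/
def shiftSet (i j : ℕ) (A : Finset (Finset ℕ)) (X : Finset ℕ) : Finset ℕ :=
  if j ∈ X ∧ i ∉ X ∧ move i j X ∉ A then move i j X else X

/-- The shift of a family, replacing `j` by `i` wherever possible. -/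
def shift (i j : ℕ) (A : Finset (Finset ℕ)) : Finset (Finset ℕ) :=
  A.image (shiftSet i j A)

lemma move_move {i j : ℕ} {X : Finset ℕ} (hj : j ∈ X) (hi : i ∉ X) : move j i (move i j X) = X := by
  rw [move, move, erase_insert (fun h => hi (mem_of_mem_erase h)), insert_erase hj]

lemma shiftSet_mem_or {i j : ℕ} {A : Finset (Finset ℕ)} {X : Finset ℕ} :
    shiftSet i j A X = X ∨
      (j ∈ X ∧ i ∉ X ∧ move i j X ∉ A ∧ shiftSet i j A X = move i j X) := by
  rw [shiftSet]
  split_ifs with h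
  · exact Or.inr ⟨h.1, h.2.1, h.2.2, rfl⟩
  · exact Or.inl rfl

lemma shiftSet_injOn (i j : ℕ) (A : Finset (Finset ℕ)) :
    Set.InjOn (shiftSet i j A) (A : Set (Finset ℕ)) := by
  intro X hX Y hY hXY
  rw [mem_coe] at hX hY
  rcases shiftSet_mem_or (i := i) (j := j) (A := A) (X := X) with h1 | ⟨a1, b1, c1, d1⟩ <;>
  rcases shiftSet_mem_or (i := i) (j := j) (A := A) (X := Y) with h2 | ⟨a2, b2, c2, d2⟩
  · rwa [h1, h2] at hXY
  · rw [h1, d2] at hXY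
    exact absurd (hXY ▸ hX) c2
  · rw [h2, d1] at hXY
    exact absurd (hXY ▸ hY) c1
  · rw [d1, d2] at hXY
    rw [← move_move a1 b1, ← move_move a2 b2, hXY]

lemma card_shift (i j : ℕ) (A : Finset (Finset ℕ)) : #(shift i j A) = #A :=
  card_image_of_injOn (shiftSet_injOn i j A)

lemma shift_subset {i j k : ℕ} {V : Finset ℕ} {A : Finset (Finset ℕ)} (hi : i ∈ V)
    (hA : A ⊆ V.powersetCard k) : shift i j A ⊆ V.powersetCard k := by
  intro X hX
  obtain ⟨X, hXA, rfl⟩ := mem_image.1 hX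
  rcases shiftSet_mem_or (i := i) (j := j) (A := A) (X := X) with h1 | ⟨a1, b1, _, d1⟩
  · rw [h1]; exact hA hXA
  · have h := mem_powersetCard.1 (hA hXA)
    have : 0 < #X := card_pos.2 ⟨j, a1⟩
    rw [d1, mem_powersetCard, move, card_insert_of_notMem (fun h => b1 (mem_of_mem_erase h)),
      card_erase_of_mem a1]
    exact ⟨insert_subset hi ((erase_subset _ _).trans h.1), by omega⟩

lemma cross_shift {i j : ℕ} {A B : Finset (Finset ℕ)} (h : Cross A B) :
    Cross (shift i j A) (shift i j B) := by
  have aux : ∀ {A B : Finset (Finset ℕ)}, Cross A B → ∀ X ∈ A, j ∈ X → i ∉ X → ∀ Y ∈ B,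
      shiftSet i j B Y = Y → ¬ Disjoint (move i j X) Y := by
    intro A B h X hX hjX hiX Y hY hYs hd
    rw [move, disjoint_insert_left] at hd
    by_cases hjY : j ∈ Y
    · have hm : move i j Y ∈ B := by
        by_contra hm
        rw [shiftSet, if_pos ⟨hjY, hd.1, hm⟩] at hYs
        exact hd.1 (hYs ▸ mem_insert_self i _)
      refine h X hX _ hm ?_
      rw [move, disjoint_insert_right]
      refine ⟨hiX, ?_⟩
      rw [disjoint_left] at hd ⊢
      intro x hx hx'
      rw [mem_erase] at hx'
      exact hd.2 (mem_erase.2 ⟨hx'.1, hx⟩) hx'.2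
    · refine h X hX Y hY ?_
      rw [← insert_erase hjX, disjoint_insert_left]
      exact ⟨hjY, hd.2⟩
  intro X hX Y hY
  obtain ⟨X, hXA, rfl⟩ := mem_image.1 hX
  obtain ⟨Y, hYB, rfl⟩ := mem_image.1 hY
  rcases shiftSet_mem_or (i := i) (j := j) (A := A) (X := X) with h1 | ⟨a1, b1, c1, d1⟩ <;>
  rcases shiftSet_mem_or (i := i) (j := j) (A := B) (X := Y) with h2 | ⟨a2, b2, c2, d2⟩
  · rw [h1, h2]; exact h X hXA Y hYB
  · rw [d2, h1]
    exact fun hd => aux h.symm Y hYB a2 b2 X hXA h1 hd.symm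
  · rw [h2, d1]
    exact aux h X hXA a1 b1 Y hYB h2
  · rw [d1, d2, disjoint_left]
    exact fun hd => hd (mem_insert_self i _) (mem_insert_self i _)

/-- The sum of all elements of all members. -/
def weight (A : Finset (Finset ℕ)) : ℕ := ∑ X ∈ A, ∑ x ∈ X, x

lemma sum_move_lt {i j : ℕ} {X : Finset ℕ} (hj : j ∈ X) (hi : i ∉ X) (hij : i < j) :
    ∑ x ∈ move i j X, x < ∑ x ∈ X, x := by
  rw [move, sum_insert (fun h => hi (mem_of_mem_erase h)), ← add_sum_erase X (fun x => x) hj]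
  exact Nat.add_lt_add_right hij _

lemma sum_shiftSet_le {i j : ℕ} (A : Finset (Finset ℕ)) (X : Finset ℕ) (hij : i < j) :
    ∑ x ∈ shiftSet i j A X, x ≤ ∑ x ∈ X, x := by
  rcases shiftSet_mem_or (i := i) (j := j) (A := A) (X := X) with h1 | ⟨a1, b1, c1, d1⟩
  · rw [h1]
  · rw [d1]; exact (sum_move_lt a1 b1 hij).le

lemma weight_shift_le {i j : ℕ} (A : Finset (Finset ℕ)) (hij : i < j) :
    weight (shift i j A) ≤ weight A := by
  rw [weight, shift, sum_image (shiftSet_injOn i j A)]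
  exact sum_le_sum fun X _ => sum_shiftSet_le A X hij

lemma weight_shift_lt {i j : ℕ} {A : Finset (Finset ℕ)} {X : Finset ℕ} (hij : i < j) (hX : X ∈ A)
    (hj : j ∈ X) (hi : i ∉ X) (hm : move i j X ∉ A) : weight (shift i j A) < weight A := by
  rw [weight, shift, sum_image (shiftSet_injOn i j A)]
  refine sum_lt_sum (fun X _ => sum_shiftSet_le A X hij) ⟨X, hX, ?_⟩
  rw [shiftSet, if_pos ⟨hj, hi, hm⟩]
  exact sum_move_lt hj hi hij

lemma exists_shift_of_not_isShifted {V : Finset ℕ} {A : Finset (Finset ℕ)} (h : ¬ IsShifted V A) :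
    ∃ i ∈ V, ∃ j, i < j ∧ (∃ X ∈ A, j ∈ X ∧ i ∉ X ∧ move i j X ∉ A) := by
  rw [IsShifted] at h
  push Not at h
  obtain ⟨X, hX, i, hi, j, hj, hij, hiX, hm⟩ := h
  exact ⟨i, hi, j, hij, X, hX, hj, hiX, hm⟩

/-- Cross-intersecting families of `l`-sets, each with at least two members. -/
lemma Cross.card_le {V : Finset ℕ} {l : ℕ} (hl : 4 ≤ l) (hV : 2 * l + 1 ≤ #V) (N : ℕ) :
    ∀ A B : Finset (Finset ℕ), weight A + weight B = N → A ⊆ V.powersetCard l →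
    B ⊆ V.powersetCard l → Cross A B → 2 ≤ #A → 2 ≤ #B →
    #A + #B + (#V - l).choose l + (#V - l - 1).choose (l - 1) ≤ (#V).choose l + 2 ∧
    (3 ≤ #A → 3 ≤ #B →
      #A + #B + (#V - l).choose l + (#V - l - 1).choose (l - 1) < (#V).choose l + 2) := by
  induction N using Nat.strong_induction_on with
  | _ N ih =>
    intro A B hN hA hB h hA2 hB2
    have key : ∀ i ∈ V, ∀ j, i < j → weight (shift i j A) +
        weight (shift i j B) < N →
        #A + #B + (#V - l).choose l + (#V - l - 1).choose (l - 1) ≤ (#V).choose l + 2 ∧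
        (3 ≤ #A → 3 ≤ #B →
          #A + #B + (#V - l).choose l + (#V - l - 1).choose (l - 1) < (#V).choose l + 2) := by
      intro i hi j hij hlt
      have := ih _ hlt _ _ rfl (shift_subset hi hA) (shift_subset hi hB) (cross_shift h)
        (by rwa [card_shift]) (by rwa [card_shift])
      rwa [card_shift, card_shift] at this
    by_cases hsA : IsShifted V A
    · by_cases hsB : IsShifted V B
      · exact card_le_of_isShifted hl hV hA hB h hsA hsB hA2 hB2
      · obtain ⟨i, hi, j, hij, X, hX, a, b, c⟩ := exists_shift_of_not_isShifted hsB
        have h1 := weight_shift_lt hij hX a b c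
        have h2 := weight_shift_le A hij
        exact key i hi j hij (by omega)
    · obtain ⟨i, hi, j, hij, X, hX, a, b, c⟩ := exists_shift_of_not_isShifted hsA
      have h1 := weight_shift_lt hij hX a b c
      have h2 := weight_shift_le B hij
      exact key i hi j hij (by omega)

lemma member_nonMember_comm {x y : ℕ} (hxy : x ≠ y) (F : Finset (Finset ℕ)) :
    (F.nonMemberSubfamily y).memberSubfamily x = (F.memberSubfamily x).nonMemberSubfamily y := by
  ext X
  simp only [mem_memberSubfamily, mem_nonMemberSubfamily, mem_insert, not_or]
  tauto

lemma nonMember_comm (x y : ℕ) (F : Finset (Finset ℕ)) :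
    (F.nonMemberSubfamily y).nonMemberSubfamily x =
      (F.nonMemberSubfamily x).nonMemberSubfamily y := by
  ext X
  simp only [mem_nonMemberSubfamily]
  tauto

lemma card_nonMember {x y : ℕ} (hxy : x ≠ y) (F : Finset (Finset ℕ)) :
    #((F.memberSubfamily x).nonMemberSubfamily y) + #((F.nonMemberSubfamily x).nonMemberSubfamily y)
      = #(F.nonMemberSubfamily y) := by
  rw [← member_nonMember_comm hxy, ← nonMember_comm,
    card_memberSubfamily_add_card_nonMemberSubfamily]

/-- The bound on `F`, strict if every element is missed by at least three members. -/
def Bound (V : Finset ℕ) (k : ℕ) (F : Finset (Finset ℕ)) : Prop :=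
  #F + (#V - k - 1).choose (k - 1) + (#V - k - 2).choose (k - 2) ≤ (#V - 1).choose (k - 1) + 2 ∧
  ((∀ c ∈ V, 3 ≤ #(F.nonMemberSubfamily c)) →
    #F + (#V - k - 1).choose (k - 1) + (#V - k - 2).choose (k - 2) < (#V - 1).choose (k - 1) + 2)

section

variable {V : Finset ℕ} {k : ℕ} {F : Finset (Finset ℕ)}

lemma bound_of_pair (hk : 5 ≤ k) (hV : 2 * k < #V) (hF : F ⊆ V.powersetCard k) (h : Cross F F)
    {x y : ℕ} (hx : x ∈ V) (hy : y ∈ V) (hxy : x ≠ y)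
    (hA : 2 ≤ #((F.memberSubfamily x).nonMemberSubfamily y))
    (hB : 2 ≤ #((F.nonMemberSubfamily x).memberSubfamily y))
    (hCD : #((F.memberSubfamily x).memberSubfamily y) +
      #((F.nonMemberSubfamily x).nonMemberSubfamily y) ≤ (#V - 2).choose (k - 2)) :
    #F + (#V - k - 1).choose (k - 1) + (#V - k - 2).choose (k - 2) ≤ (#V - 1).choose (k - 1) + 2 ∧
    (#((F.memberSubfamily x).memberSubfamily y) +
      #((F.nonMemberSubfamily x).nonMemberSubfamily y) < (#V - 2).choose (k - 2) ∨
      (3 ≤ #((F.memberSubfamily x).nonMemberSubfamily y) ∧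
        3 ≤ #((F.nonMemberSubfamily x).memberSubfamily y)) →
    #F + (#V - k - 1).choose (k - 1) + (#V - k - 2).choose (k - 2) <
      (#V - 1).choose (k - 1) + 2) := by
  have hyx : y ∈ V.erase x := mem_erase.2 ⟨hxy.symm, hy⟩
  have hW : #((V.erase x).erase y) = #V - 2 := by
    rw [card_erase_of_mem hyx, card_erase_of_mem hx]; omega
  obtain ⟨i1, i2⟩ := Cross.card_le (V := (V.erase x).erase y) (l := k - 1) (by omega) (by omega) _
    _ _ rfl (nonMember_subset (member_subset hF x) y) (member_subset (nonMember_subset hF x) y)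
    ((h.member_nonMember x).symm.member_nonMember y).symm hA hB
  have c1 := card_memberSubfamily_add_card_nonMemberSubfamily x F
  have c2 := card_memberSubfamily_add_card_nonMemberSubfamily y (F.memberSubfamily x)
  have c3 := card_memberSubfamily_add_card_nonMemberSubfamily y (F.nonMemberSubfamily x)
  rw [hW] at i1 i2
  have e1 : #V - 2 - (k - 1) = #V - k - 1 := by omega
  have e2 : #V - k - 1 - 1 = #V - k - 2 := by omega
  have e3 : k - 1 - 1 = k - 2 := by omega
  rw [e1, e2, e3] at i1 i2
  have hp : (#V - 1).choose (k - 1) = (#V - 2).choose (k - 2) + (#V - 2).choose (k - 1) := by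
    obtain ⟨m, hm⟩ := Nat.exists_eq_add_of_le (by omega : 2 ≤ #V)
    obtain ⟨l, rfl⟩ := Nat.exists_eq_add_of_le (by omega : 2 ≤ k)
    rw [hm, show 2 + m - 1 = m + 1 by omega, show 2 + l - 1 = l + 1 by omega,
      show 2 + m - 2 = m by omega, show 2 + l - 2 = l by omega, Nat.choose_succ_succ']
  rw [hp]
  refine ⟨by omega, ?_⟩
  rintro (h1 | ⟨h1, h2⟩)
  · omega
  · have := i2 h1 h2
    omega

lemma bound_of_cover (hk : 5 ≤ k) (hV : 2 * k < #V) (hF : F ⊆ V.powersetCard k) (h : Cross F F)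
    (h2 : ∀ c ∈ V, 2 ≤ #(F.nonMemberSubfamily c))
    {x y : ℕ} (hx : x ∈ V) (hy : y ∈ V) (hxy : x ≠ y)
    (hD : (F.nonMemberSubfamily x).nonMemberSubfamily y = ∅) : Bound V k F := by
  have c1 := card_nonMember hxy F
  have c2 := card_memberSubfamily_add_card_nonMemberSubfamily y (F.nonMemberSubfamily x)
  have hyx : y ∈ V.erase x := mem_erase.2 ⟨hxy.symm, hy⟩
  have hW : #((V.erase x).erase y) = #V - 2 := by
    rw [card_erase_of_mem hyx, card_erase_of_mem hx]; omega
  have hC := card_le_card (member_subset (member_subset hF x) y)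
  rw [card_powersetCard, hW, show k - 1 - 1 = k - 2 by omega] at hC
  rw [hD, card_empty] at c1 c2
  obtain ⟨i1, i2⟩ := bound_of_pair hk hV hF h hx hy hxy (by have := h2 y hy; omega)
    (by have := h2 x hx; omega) (by rw [hD, card_empty]; omega)
  exact ⟨i1, fun h3 => i2 (Or.inr ⟨by have := h3 y hy; omega, by have := h3 x hx; omega⟩)⟩

lemma bound_of_small (hk : 5 ≤ k) (hV : 2 * k < #V) (hF : F ⊆ V.powersetCard k) (h : Cross F F)
    {x y : ℕ} (hx : x ∈ V) (hy : y ∈ V) (hxy : x ≠ y)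
    (hA : 2 ≤ #((F.memberSubfamily x).nonMemberSubfamily y))
    (hB : 2 ≤ #((F.nonMemberSubfamily x).memberSubfamily y))
    (hD : ((F.nonMemberSubfamily x).nonMemberSubfamily y).Nonempty)
    (hD2 : #((F.nonMemberSubfamily x).nonMemberSubfamily y) ≤ 2) : Bound V k F := by
  have hyx : y ∈ V.erase x := mem_erase.2 ⟨hxy.symm, hy⟩
  have hW : #((V.erase x).erase y) = #V - 2 := by
    rw [card_erase_of_mem hyx, card_erase_of_mem hx]; omega
  obtain ⟨Z, hZ⟩ := hD
  have hZ' := mem_powersetCard.1 (nonMember_subset (nonMember_subset hF x) y hZ)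
  have hC := card_add_choose_le (member_subset (member_subset hF x) y) hZ'.1
    (fun X hX => (h.member_nonMember x).member_nonMember y X hX Z hZ)
  rw [hW, hZ'.2, show k - 1 - 1 = k - 2 by omega] at hC
  have hc : 3 ≤ (#V - 2 - k).choose (k - 2) := by
    calc 3 ≤ k - 2 + 1 := by omega
      _ = (k - 2 + 1).choose (k - 2) := (Nat.choose_succ_self_right _).symm
      _ ≤ _ := Nat.choose_le_choose _ (by omega)
  obtain ⟨i1, i2⟩ := bound_of_pair hk hV hF h hx hy hxy hA hB (by omega)
  exact ⟨i1, fun _ => i2 (Or.inl (by omega))⟩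

lemma exists_two_le_card_member (hF : F ⊆ V.powersetCard k) (h : Cross F F) {c : ℕ}
    (h2 : 2 ≤ #(F.nonMemberSubfamily c)) :
    ∃ y ∈ V, c ≠ y ∧ 2 ≤ #((F.nonMemberSubfamily c).memberSubfamily y) := by
  obtain ⟨X, hX, Y, hY, hXY⟩ := one_lt_card.1 h2
  have hX' := mem_nonMemberSubfamily.1 hX
  have hY' := mem_nonMemberSubfamily.1 hY
  obtain ⟨y, hyX, hyY⟩ := not_disjoint_iff.1 (h X hX'.1 Y hY'.1)
  refine ⟨y, (mem_powersetCard.1 (hF hX'.1)).1 hyX, fun h => hX'.2 (h ▸ hyX), ?_⟩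
  refine one_lt_card.2 ⟨X.erase y, ?_, Y.erase y, ?_, ?_⟩
  · rw [mem_memberSubfamily, insert_erase hyX]; exact ⟨hX, notMem_erase _ _⟩
  · rw [mem_memberSubfamily, insert_erase hyY]; exact ⟨hY, notMem_erase _ _⟩
  · intro he
    exact hXY (by rw [← insert_erase hyX, he, insert_erase hyY])

lemma bound_of_le_two (hk : 5 ≤ k) (hV : 2 * k < #V) (hF : F ⊆ V.powersetCard k) (h : Cross F F)
    (h2 : ∀ c ∈ V, 2 ≤ #(F.nonMemberSubfamily c)) {c : ℕ} (hc : c ∈ V)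
    (hc2 : #(F.nonMemberSubfamily c) ≤ 2) : Bound V k F := by
  obtain ⟨y, hy, hcy, hB⟩ := exists_two_le_card_member hF h (h2 c hc)
  have c2 := card_memberSubfamily_add_card_nonMemberSubfamily y (F.nonMemberSubfamily c)
  exact bound_of_cover hk hV hF h h2 hc hy hcy (card_eq_zero.1 (by omega))

lemma bound_of_le_three (hk : 5 ≤ k) (hV : 2 * k < #V) (hF : F ⊆ V.powersetCard k)
    (h : Cross F F) (h2 : ∀ c ∈ V, 2 ≤ #(F.nonMemberSubfamily c)) {c : ℕ} (hc : c ∈ V)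
    (hc2 : #(F.nonMemberSubfamily c) ≤ 3) : Bound V k F := by
  obtain ⟨y, hy, hcy, hB⟩ := exists_two_le_card_member hF h (h2 c hc)
  have c1 := card_nonMember hcy F
  have c2 := card_memberSubfamily_add_card_nonMemberSubfamily y (F.nonMemberSubfamily c)
  rcases ((F.nonMemberSubfamily c).nonMemberSubfamily y).eq_empty_or_nonempty with hD | hD
  · exact bound_of_cover hk hV hF h h2 hc hy hcy hD
  · rcases Nat.lt_or_ge #((F.memberSubfamily c).nonMemberSubfamily y) 2 with hA | hA
    · exact bound_of_le_two hk hV hF h h2 hy (by omega)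
    · exact bound_of_small hk hV hF h hc hy hcy hA hB hD (by omega)

lemma card_nonMember_le_shift {i j c : ℕ} (hci : c ≠ i) :
    #(F.nonMemberSubfamily c) ≤ #((shift i j F).nonMemberSubfamily c) := by
  refine card_le_card_of_injOn (shiftSet i j F) ?_ ((shiftSet_injOn i j F).mono ?_)
  · intro X hX
    rw [mem_coe, mem_nonMemberSubfamily] at hX ⊢
    refine ⟨mem_image_of_mem _ hX.1, ?_⟩
    rcases shiftSet_mem_or (i := i) (j := j) (A := F) (X := X) with h1 | ⟨a1, b1, c1, d1⟩
    · rw [h1]; exact hX.2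
    · rw [d1, move, mem_insert, mem_erase]
      tauto
  · intro X hX
    exact (mem_nonMemberSubfamily.1 hX).1

lemma nonMember_nonMember_subset_shift {i j : ℕ} :
    (F.nonMemberSubfamily i).nonMemberSubfamily j ⊆ (shift i j F).nonMemberSubfamily i := by
  intro X hX
  rw [mem_nonMemberSubfamily, mem_nonMemberSubfamily] at hX
  rw [mem_nonMemberSubfamily]
  refine ⟨mem_image.2 ⟨X, hX.1.1, ?_⟩, hX.1.2⟩
  rw [shiftSet, if_neg (fun h => hX.2 h.1)]

lemma IsShifted.nonMember (h : IsShifted V F) (e : ℕ) :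
    IsShifted (V.erase e) (F.nonMemberSubfamily e) := by
  intro X hX i hi j hj hij hiX
  rw [mem_nonMemberSubfamily] at hX ⊢
  rw [mem_erase] at hi
  refine ⟨h X hX.1 i hi.2 j hj hij hiX, ?_⟩
  rw [move, mem_insert, mem_erase]
  exact fun h => h.elim (fun h => hi.1 h.symm) (fun h => hX.2 h.2)

lemma bound_of_isShifted (hk : 5 ≤ k) (hV : 2 * k < #V) (hF : F ⊆ V.powersetCard k)
    (h : Cross F F) (h2 : ∀ c ∈ V, 2 ≤ #(F.nonMemberSubfamily c)) (hs : IsShifted V F) :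
    Bound V k F := by
  obtain ⟨x, hx, hxmin⟩ := exists_min (card_pos.1 (by omega : 0 < #V))
  have hVx := card_erase_of_mem hx
  obtain ⟨y, hy, hymin⟩ := exists_min (card_pos.1 (by omega : 0 < #(V.erase x)))
  have hW := card_erase_of_mem hy
  have hyV := mem_of_mem_erase hy
  have hxy : x ≠ y := (ne_of_mem_erase hy).symm
  have hxyle := hxmin y hyV
  rcases ((F.nonMemberSubfamily x).nonMemberSubfamily y).eq_empty_or_nonempty with hD | hD
  · exact bound_of_cover hk hV hF h h2 hx hyV hxy hD
  have hB := (hs.nonMember x).le_card_member (nonMember_subset hF x) hy hymin hD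
  have hA := (hs.nonMember y).le_card_member (nonMember_subset hF y) (mem_erase.2 ⟨hxy, hx⟩)
    (fun z hz => hxmin z (mem_of_mem_erase hz)) (by rwa [nonMember_comm])
  rw [member_nonMember_comm hxy] at hA
  have hCD := card_add_card_le_of_walk ((V.erase x).erase y) (k - 2) 2
    ((F.memberSubfamily x).memberSubfamily y) ((F.nonMemberSubfamily x).nonMemberSubfamily y)
    (member_subset (member_subset hF x) y)
    (by rw [Nat.sub_add_cancel (by omega)]; exact nonMember_subset (nonMember_subset hF x) y)
    ((h.member_nonMember x).member_nonMember y).symm (by omega) (by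
      intro _ X hX
      have hXW := (mem_powersetCard.1 (nonMember_subset (nonMember_subset hF x) y hX)).1
      rw [mem_nonMemberSubfamily, mem_nonMemberSubfamily] at hX
      have hXV := (mem_powersetCard.1 (hF hX.1.1)).1
      obtain ⟨p, hp⟩ := exists_card_lt hs h hX.1.1 hXV _ X hX.1.1 hXV rfl
      refine ⟨p, ?_⟩
      obtain ⟨z, hz⟩ := card_pos.1 (by omega : 0 < #{v ∈ X | v ≤ p})
      rw [mem_filter] at hz
      have hyp := (hymin z (mem_of_mem_erase (hXW hz.1))).trans hz.2
      have hxp := hxyle.trans hyp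
      rw [filter_erase, filter_erase, card_erase_of_mem (by simp [hxy.symm, hyV, hyp]),
        card_erase_of_mem (by simp [hx, hxp])]
      have : 1 < #{v ∈ V | v ≤ p} :=
        one_lt_card.2 ⟨x, by simp [hx, hxp], y, by simp [hyV, hyp], hxy⟩
      omega)
  rw [hW, hVx, show #V - 1 - 1 = #V - 2 by omega] at hCD
  obtain ⟨i1, i2⟩ := bound_of_pair hk hV hF h hx hyV hxy (by omega) (by omega) hCD
  exact ⟨i1, fun _ => i2 (Or.inr ⟨by omega, by omega⟩)⟩

end

lemma bound_of_two_le {V : Finset ℕ} {k : ℕ} (hk : 5 ≤ k) (hV : 2 * k < #V) (N : ℕ) :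
    ∀ F : Finset (Finset ℕ), weight F = N → F ⊆ V.powersetCard k → Cross F F →
      (∀ c ∈ V, 2 ≤ #(F.nonMemberSubfamily c)) → Bound V k F := by
  induction N using Nat.strong_induction_on with
  | _ N ih =>
    intro F hN hF h h2
    by_cases hs : IsShifted V F
    · exact bound_of_isShifted hk hV hF h h2 hs
    obtain ⟨i, hi, j, hij, X, hX, hjX, hiX, hm⟩ := exists_shift_of_not_isShifted hs
    have hj : j ∈ V := (mem_powersetCard.1 (hF hX)).1 hjX
    by_cases h3 : ∀ c ∈ V, 3 ≤ #((shift i j F).nonMemberSubfamily c)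
    · have hw := weight_shift_lt hij hX hjX hiX hm
      have := (ih _ (hN ▸ hw) _ rfl (shift_subset hi hF) (cross_shift h)
        (fun c hc => le_of_lt (h3 c hc))).2 h3
      rw [card_shift] at this
      exact ⟨this.le, fun _ => this⟩
    · push Not at h3
      obtain ⟨c, hc, hc3⟩ := h3
      by_cases hci : c = i
      · subst hci
        have hD2 := card_le_card (nonMember_nonMember_subset_shift (F := F) (i := c) (j := j))
        have c1 := card_nonMember hij.ne F
        have c2 := card_memberSubfamily_add_card_nonMemberSubfamily j (F.nonMemberSubfamily c)
        rcases ((F.nonMemberSubfamily c).nonMemberSubfamily j).eq_empty_or_nonempty with hD | hD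
        · exact bound_of_cover hk hV hF h h2 hc hj hij.ne hD
        rcases Nat.lt_or_ge #((F.memberSubfamily c).nonMemberSubfamily j) 2 with hA | hA
        · exact bound_of_le_three hk hV hF h h2 hj (by omega)
        rcases Nat.lt_or_ge #((F.nonMemberSubfamily c).memberSubfamily j) 2 with hB | hB
        · exact bound_of_le_three hk hV hF h h2 hc (by omega)
        exact bound_of_small hk hV hF h hc hj hij.ne hA hB hD (by omega)
      · have := card_nonMember_le_shift (F := F) (j := j) hci
        exact bound_of_le_two hk hV hF h h2 hc (by omega)

lemma exists_perm_of_colorings {V : Finset ℕ} {f g : ℕ → ℕ} (hf : ∀ a, f a = 0 ↔ a ∉ V)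
    (hg : ∀ a, g a = 0 ↔ a ∉ V) (h : ∀ c, #{v ∈ V | f v = c} = #{v ∈ V | g v = c}) :
    ∃ σ : Equiv.Perm ℕ, ∀ a, g (σ a) = f a := by
  have e : ∀ c, Nonempty ({a // f a = c} ≃ {a // g a = c}) := by
    intro c
    rcases eq_or_ne c 0 with rfl | hc
    · exact ⟨Equiv.subtypeEquivRight fun a => by rw [hf, hg]⟩
    · have hf' : ∀ a, f a = c ↔ a ∈ ({v ∈ V | f v = c} : Finset ℕ) := by
        intro a
        rw [mem_filter]
        refine ⟨fun ha => ⟨?_, ha⟩, fun ha => ha.2⟩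
        by_contra haV
        exact hc (ha ▸ (hf a).2 haV)
      have hg' : ∀ a, a ∈ ({v ∈ V | g v = c} : Finset ℕ) ↔ g a = c := by
        intro a
        rw [mem_filter]
        refine ⟨fun ha => ha.2, fun ha => ⟨?_, ha⟩⟩
        by_contra haV
        exact hc (ha ▸ (hg a).2 haV)
      exact ⟨(Equiv.subtypeEquivRight hf').trans
        ((equivOfCardEq (h c)).trans (Equiv.subtypeEquivRight hg'))⟩
  exact ⟨Equiv.ofFiberEquiv fun c => (e c).some, fun a => Equiv.ofFiberEquiv_map _ a⟩

/-- The coloring of `V` by four disjoint subsets and the remainder, with color `0` outside `V`. -/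
def coloring (V P Q R T : Finset ℕ) (a : ℕ) : ℕ :=
  if a ∈ P then 1 else if a ∈ Q then 2 else if a ∈ R then 3 else if a ∈ T then 4
  else if a ∈ V then 5 else 0

section coloring

variable {V P Q R T : Finset ℕ}

lemma coloring_eq_zero (hP : P ⊆ V) (hQ : Q ⊆ V) (hR : R ⊆ V) (hT : T ⊆ V) (a : ℕ) :
    coloring V P Q R T a = 0 ↔ a ∉ V := by
  rw [coloring]
  have := @hP a
  have := @hQ a
  have := @hR a
  have := @hT a
  split_ifs <;> simp_all

lemma coloring_mem (h12 : Disjoint P Q) (h13 : Disjoint P R) (h14 : Disjoint P T)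
    (h23 : Disjoint Q R) (h24 : Disjoint Q T) (h34 : Disjoint R T) (a : ℕ) :
    (coloring V P Q R T a = 1 ↔ a ∈ P) ∧ (coloring V P Q R T a = 2 ↔ a ∈ Q) ∧
    (coloring V P Q R T a = 3 ↔ a ∈ R) ∧ (coloring V P Q R T a = 4 ↔ a ∈ T) := by
  rw [disjoint_left] at *
  have := @h12 a
  have := @h13 a
  have := @h14 a
  have := @h23 a
  have := @h24 a
  have := @h34 a
  rw [coloring]
  split_ifs <;> simp_all

lemma card_coloring (hP : P ⊆ V) (hQ : Q ⊆ V) (hR : R ⊆ V) (hT : T ⊆ V) (h12 : Disjoint P Q)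
    (h13 : Disjoint P R) (h14 : Disjoint P T)
    (h23 : Disjoint Q R) (h24 : Disjoint Q T) (h34 : Disjoint R T) (c : ℕ) :
    #{v ∈ V | coloring V P Q R T v = c} = if c = 1 then #P else if c = 2 then #Q else
      if c = 3 then #R else if c = 4 then #T else if c = 5 then #V - (#P + #Q + #R + #T)
      else 0 := by
  have hm := coloring_mem (V := V) h12 h13 h14 h23 h24 h34
  split_ifs with h1 h2 h3 h4 h5
  · subst h1
    congr 1
    ext a
    rw [mem_filter, (hm a).1]
    exact ⟨fun h => h.2, fun h => ⟨hP h, h⟩⟩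
  · subst h2
    congr 1
    ext a
    rw [mem_filter, (hm a).2.1]
    exact ⟨fun h => h.2, fun h => ⟨hQ h, h⟩⟩
  · subst h3
    congr 1
    ext a
    rw [mem_filter, (hm a).2.2.1]
    exact ⟨fun h => h.2, fun h => ⟨hR h, h⟩⟩
  · subst h4
    congr 1
    ext a
    rw [mem_filter, (hm a).2.2.2]
    exact ⟨fun h => h.2, fun h => ⟨hT h, h⟩⟩
  · subst h5
    have hu : P ∪ Q ∪ R ∪ T ⊆ V := union_subset (union_subset (union_subset hP hQ) hR) hT
    rw [← card_union_of_disjoint h12,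
      ← card_union_of_disjoint (disjoint_union_left.2 ⟨h13, h23⟩),
      ← card_union_of_disjoint
        (disjoint_union_left.2 ⟨disjoint_union_left.2 ⟨h14, h24⟩, h34⟩),
      ← card_sdiff_of_subset hu]
    congr 1
    ext a
    rw [mem_filter, mem_sdiff, coloring]
    simp only [mem_union]
    split_ifs <;> simp_all
  · rw [card_eq_zero, filter_eq_empty_iff]
    intro a ha
    rw [coloring]
    split_ifs <;> omega

end coloring

/-- A permutation of `V` carrying four disjoint subsets to four others of the same sizes. -/
lemma exists_perm {V P Q R T P' Q' R' T' : Finset ℕ}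
    (hP : P ⊆ V) (hQ : Q ⊆ V) (hR : R ⊆ V) (hT : T ⊆ V) (h12 : Disjoint P Q)
    (h13 : Disjoint P R) (h14 : Disjoint P T)
    (h23 : Disjoint Q R) (h24 : Disjoint Q T) (h34 : Disjoint R T)
    (hP' : P' ⊆ V) (hQ' : Q' ⊆ V) (hR' : R' ⊆ V) (hT' : T' ⊆ V) (h12' : Disjoint P' Q')
    (h13' : Disjoint P' R') (h14' : Disjoint P' T')
    (h23' : Disjoint Q' R') (h24' : Disjoint Q' T') (h34' : Disjoint R' T')
    (cP : #P = #P') (cQ : #Q = #Q') (cR : #R = #R') (cT : #T = #T') :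
    ∃ σ : Equiv.Perm ℕ, V.image σ = V ∧ (∀ a, σ a ∈ P' ↔ a ∈ P) ∧ (∀ a, σ a ∈ Q' ↔ a ∈ Q) ∧
      (∀ a, σ a ∈ R' ↔ a ∈ R) ∧ (∀ a, σ a ∈ T' ↔ a ∈ T) := by
  obtain ⟨σ, hσ⟩ := exists_perm_of_colorings (coloring_eq_zero hP hQ hR hT)
    (coloring_eq_zero hP' hQ' hR' hT') (fun c => by
      rw [card_coloring hP hQ hR hT h12 h13 h14 h23 h24 h34,
        card_coloring hP' hQ' hR' hT' h12' h13' h14' h23' h24' h34', cP, cQ, cR, cT])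
  have hm := coloring_mem (V := V) h12 h13 h14 h23 h24 h34
  have hm' := coloring_mem (V := V) h12' h13' h14' h23' h24' h34'
  refine ⟨σ, ?_, fun a => ?_, fun a => ?_, fun a => ?_, fun a => ?_⟩
  · refine eq_of_subset_of_card_le ?_ (card_image_of_injective _ σ.injective).ge
    intro b hb
    obtain ⟨a, ha, rfl⟩ := mem_image.1 hb
    by_contra hσa
    rw [← coloring_eq_zero hP' hQ' hR' hT', hσ, coloring_eq_zero hP hQ hR hT] at hσa
    exact hσa ha
  · rw [← (hm a).1, ← (hm' _).1, hσ]
  · rw [← (hm a).2.1, ← (hm' _).2.1, hσ]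
  · rw [← (hm a).2.2.1, ← (hm' _).2.2.1, hσ]
  · rw [← (hm a).2.2.2, ← (hm' _).2.2.2, hσ]

/-- The number of `k`-subsets of `V` containing `P` and avoiding `Q`. -/
lemma card_filter_subset_disjoint {V P Q : Finset ℕ} {k : ℕ} (hP : P ⊆ V) (hQ : Q ⊆ V)
    (hPQ : Disjoint P Q) (hk : #P ≤ k) :
    #{X ∈ V.powersetCard k | P ⊆ X ∧ Disjoint X Q} = (#V - #P - #Q).choose (k - #P) := by
  rw [← card_sdiff_of_subset hP, ← card_sdiff_of_subset (subset_sdiff.2 ⟨hQ, hPQ.symm⟩),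
    ← card_powersetCard]
  refine card_bij' (fun X _ => X \ P) (fun X _ => X ∪ P) ?_ ?_ ?_ ?_
  · intro X hX
    rw [mem_filter, mem_powersetCard] at hX
    rw [mem_powersetCard, card_sdiff_of_subset hX.2.1, hX.1.2, subset_sdiff]
    exact ⟨⟨sdiff_subset_sdiff hX.1.1 le_rfl, hX.2.2.mono_left sdiff_subset⟩, rfl⟩
  · intro X hX
    rw [mem_powersetCard, subset_sdiff, subset_sdiff] at hX
    rw [mem_filter, mem_powersetCard, card_union_of_disjoint hX.1.1.2, hX.2]
    exact ⟨⟨union_subset hX.1.1.1 hP, by omega⟩, subset_union_right,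
      disjoint_union_left.2 ⟨hX.1.2, hPQ⟩⟩
  · intro X hX
    rw [mem_filter] at hX
    exact sdiff_union_of_subset hX.2.1
  · intro X hX
    rw [mem_powersetCard, subset_sdiff, subset_sdiff] at hX
    exact union_sdiff_cancel_right hX.1.1.2

/-- The two members avoiding `c` in an extremal family are neighbours. -/
lemma card_sdiff_le_one {V Y Z : Finset ℕ} {k c : ℕ} {F : Finset (Finset ℕ)} (hk : 5 ≤ k)
    (hV : 2 * k < #V) (hF : F ⊆ V.powersetCard k) (h : Cross F F) (hc : c ∈ V)
    (hG : #(F.nonMemberSubfamily c) = 2) (hY : Y ∈ F.nonMemberSubfamily c)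
    (hZ : Z ∈ F.nonMemberSubfamily c)
    (hcard : #F + (#V - k - 1).choose (k - 1) + (#V - k - 2).choose (k - 2) =
      (#V - 1).choose (k - 1) + 2) : #(Y \ Z) ≤ 1 := by
  by_contra! hlt
  obtain ⟨z, hz, w, hw, hzw⟩ := one_lt_card.1 hlt
  rw [mem_sdiff] at hz hw
  rw [mem_nonMemberSubfamily] at hY hZ
  have hYV := mem_powersetCard.1 (hF hY.1)
  have hZV := mem_powersetCard.1 (hF hZ.1)
  have hzV := hYV.1 hz.1
  have hwV := hYV.1 hw.1
  have hcz : c ≠ z := fun h => hY.2 (h ▸ hz.1)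
  have hcw : c ≠ w := fun h => hY.2 (h ▸ hw.1)
  have n0 := card_filter_subset_disjoint (k := k) (singleton_subset_iff.2 hc) (empty_subset V)
    (disjoint_empty_right _) (by rw [card_singleton]; omega)
  have n1 := card_filter_subset_disjoint (k := k) (singleton_subset_iff.2 hc) hYV.1
    (disjoint_singleton_left.2 hY.2) (by rw [card_singleton]; omega)
  have n2 := card_filter_subset_disjoint (k := k) (P := {c, z}) (Q := Z)
    (insert_subset hc (singleton_subset_iff.2 hzV)) hZV.1
    (by simp [hZ.2, hz.2]) (by rw [card_pair hcz]; omega)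
  have n3 := card_filter_subset_disjoint (k := k) (P := {c, w}) (Q := insert z Z)
    (insert_subset hc (singleton_subset_iff.2 hwV)) (insert_subset hzV hZV.1)
    (by simp [hZ.2, hw.2, hcz.symm, hzw]) (by rw [card_pair hcw]; omega)
  rw [card_singleton, card_empty, Nat.sub_zero] at n0
  rw [card_singleton, hYV.2, Nat.sub_right_comm] at n1
  rw [card_pair hcz, hZV.2, Nat.sub_right_comm] at n2
  rw [card_pair hcw, card_insert_of_notMem hz.2, hZV.2] at n3
  have n3pos : 0 < (#V - 2 - (k + 1)).choose (k - 2) := Nat.choose_pos (by omega)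
  have hsplit := card_filter_add_card_filter_not (s := F) (fun X => c ∈ X)
  have hG' : #{X ∈ F | c ∉ X} = 2 := hG
  have hle : #({X ∈ V.powersetCard k | {c} ⊆ X ∧ Disjoint X Y} ∪
      ({X ∈ V.powersetCard k | {c, z} ⊆ X ∧ Disjoint X Z} ∪
      ({X ∈ V.powersetCard k | {c, w} ⊆ X ∧ Disjoint X (insert z Z)} ∪ {X ∈ F | c ∈ X}))) ≤
      #{X ∈ V.powersetCard k | {c} ⊆ X ∧ Disjoint X ∅} := by
    refine card_le_card fun X hX => ?_
    simp only [mem_union, mem_filter, insert_subset_iff, singleton_subset_iff] at hX ⊢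
    refine ⟨?_, ?_, disjoint_empty_right _⟩
    · rcases hX with h | h | h | h
      · exact h.1
      · exact h.1
      · exact h.1
      · exact hF h.1
    · tauto
  rw [card_union_of_disjoint, card_union_of_disjoint, card_union_of_disjoint] at hle
  · omega
  · rw [disjoint_left]
    intro X hX hX'
    rw [mem_filter] at hX hX'
    exact h X hX'.1 Z hZ.1 (hX.2.2.mono_right (subset_insert _ _))
  · rw [disjoint_left]
    intro X hX hX'
    simp only [mem_union, mem_filter, insert_subset_iff, singleton_subset_iff,
      disjoint_insert_right] at hX hX'
    rcases hX' with hX' | hX'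
    · exact hX'.2.2.1 hX.2.1.2
    · exact h X hX'.1 Z hZ.1 hX.2.2
  · rw [disjoint_left]
    intro X hX hX'
    simp only [mem_union, mem_filter, insert_subset_iff, singleton_subset_iff] at hX hX'
    rcases hX' with hX' | hX' | hX'
    · exact disjoint_left.1 hX.2.2 hX'.2.1.2 hz.1
    · exact disjoint_left.1 hX.2.2 hX'.2.1.2 hw.1
    · exact h X hX'.1 Y hY.1 hX.2.2

lemma mem_familyMkj {n k : ℕ} {X : Finset ℕ} : X ∈ familyMkj n k 2 ↔
    X ∈ (Icc 1 n).powersetCard k ∧ (1 ∈ X ∧ ¬ Disjoint X (Icc 2 k) ∨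
      1 ∈ X ∧ Disjoint X (Icc 2 k) ∧ k + 1 ∈ X ∧ k + 2 ∈ X ∨
      1 ∉ X ∧ Icc 2 k ⊆ X ∧ (k + 1 ∈ X ∧ k + 2 ∉ X ∨ k + 1 ∉ X ∧ k + 2 ∈ X)) := by
  have hI : Icc (k + 1) (k + 2) = {k + 1, k + 2} := by
    ext x
    simp
    omega
  have hcard : #(X ∩ {k + 1, k + 2}) = 1 ↔
      (k + 1 ∈ X ∧ k + 2 ∉ X ∨ k + 1 ∉ X ∧ k + 2 ∈ X) := by
    by_cases h1 : k + 1 ∈ X <;> by_cases h2 : k + 2 ∈ X <;>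
      simp [h1, h2, inter_insert_of_mem, inter_insert_of_notMem]
  rw [familyMkj, mem_filter, hI, hcard, insert_subset_iff, singleton_subset_iff,
    not_disjoint_iff_nonempty_inter, disjoint_iff_inter_eq_empty]

lemma card_familyMkj {n k : ℕ} (hk : 5 ≤ k) (hn : 2 * k < n) :
    #(familyMkj n k 2) + (n - k - 1).choose (k - 1) + (n - k - 2).choose (k - 2) =
      (n - 1).choose (k - 1) + 2 := by
  set N := (Icc 1 n).powersetCard k with hN
  have hV : #(Icc 1 n) = n := by simp
  have hI : #(Icc 2 k) = k - 1 := by simp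
  have n0 := card_filter_subset_disjoint (k := k) (V := Icc 1 n) (P := {1}) (Q := ∅)
    (by simp; omega) (empty_subset _) (disjoint_empty_right _) (by rw [card_singleton]; omega)
  have n1 := card_filter_subset_disjoint (k := k) (V := Icc 1 n) (P := {1}) (Q := Icc 2 (k + 1))
    (by simp; omega) (Icc_subset_Icc (by omega) (by omega)) (by simp)
    (by rw [card_singleton]; omega)
  have n2 := card_filter_subset_disjoint (k := k) (V := Icc 1 n) (P := {1, k + 1})
    (Q := insert (k + 2) (Icc 2 k))
    (by intro x; simp; omega) (by intro x; simp; omega) (by simp)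
    (by rw [card_pair (by omega)]; omega)
  have n3 := card_filter_subset_disjoint (k := k) (V := Icc 1 n) (P := insert (k + 1) (Icc 2 k))
    (Q := {1, k + 2}) (by intro x; simp; omega) (by intro x; simp; omega)
    (by simp; omega) (by rw [card_insert_of_notMem (by simp), hI]; omega)
  have n4 := card_filter_subset_disjoint (k := k) (V := Icc 1 n) (P := insert (k + 2) (Icc 2 k))
    (Q := {1, k + 1}) (by intro x; simp; omega) (by intro x; simp; omega)
    (by simp) (by rw [card_insert_of_notMem (by simp), hI]; omega)
  rw [← hN] at n0 n1 n2 n3 n4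
  rw [hV, card_singleton, card_empty, Nat.sub_zero] at n0
  rw [hV, card_singleton, Nat.card_Icc, show n - 1 - (k + 1 + 1 - 2) = n - k - 1 by omega] at n1
  rw [hV, card_pair (by omega), card_insert_of_notMem (by simp), hI,
    show n - 2 - (k - 1 + 1) = n - k - 2 by omega] at n2
  rw [card_insert_of_notMem (by simp), hI, show k - (k - 1 + 1) = 0 by omega,
    Nat.choose_zero_right] at n3 n4
  have hI2 : Icc 2 (k + 1) = insert (k + 1) (Icc 2 k) := by
    ext x
    simp
    omega
  have hcover : ∀ X : Finset ℕ, Icc 2 k ⊆ X → ¬ Disjoint X (Icc 2 k) := fun X h hX => by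
    have h2 : 2 ∈ Icc 2 k := by simp; omega
    exact disjoint_left.1 hX (h h2) h2
  have hunion : familyMkj n k 2 ∪ ({X ∈ N | {1} ⊆ X ∧ Disjoint X (Icc 2 (k + 1))} ∪
      {X ∈ N | {1, k + 1} ⊆ X ∧ Disjoint X (insert (k + 2) (Icc 2 k))}) =
      {X ∈ N | {1} ⊆ X ∧ Disjoint X ∅} ∪
      ({X ∈ N | insert (k + 1) (Icc 2 k) ⊆ X ∧ Disjoint X {1, k + 2}} ∪
       {X ∈ N | insert (k + 2) (Icc 2 k) ⊆ X ∧ Disjoint X {1, k + 1}}) := by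
    ext X
    have := hcover X
    simp only [mem_union, mem_filter, mem_familyMkj, insert_subset_iff, singleton_subset_iff,
      disjoint_insert_right, disjoint_singleton_right, hI2, disjoint_empty_right]
    by_cases h1 : 1 ∈ X <;> by_cases h2 : k + 1 ∈ X <;> by_cases h3 : k + 2 ∈ X <;>
      simp only [h1, h2, h3, true_and, and_true, false_and, and_false, or_true, false_or,
        or_false, not_true, not_false_iff] <;> tauto
  have hcard := congrArg card hunion
  rw [card_union_of_disjoint, card_union_of_disjoint, card_union_of_disjoint,
    card_union_of_disjoint, n0, n1, n2, n3, n4] at hcard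
  · omega
  all_goals
    rw [disjoint_left]
    intro X
    have := hcover X
    simp only [mem_union, mem_filter, mem_familyMkj, insert_subset_iff, singleton_subset_iff,
      disjoint_insert_right, disjoint_singleton_right, hI2, disjoint_empty_right]
    by_cases h1 : 1 ∈ X <;> by_cases h2 : k + 1 ∈ X <;> by_cases h3 : k + 2 ∈ X <;>
      simp only [h1, h2, h3, true_and, and_true, false_and, and_false, or_true, false_or,
        or_false, not_true, not_false_iff] <;> tauto
/-- A family whose members avoiding `c` reduce to a single set is contained in a copy of the
Hilton–Milner family. -/
lemma exists_perm_familyM {n k c : ℕ} (hk : 1 ≤ k) (hn : k < n) {F : Finset (Finset ℕ)}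
    {Z : Finset ℕ} (hF : F ⊆ (Icc 1 n).powersetCard k) (h : Cross F F) (hc : c ∈ Icc 1 n)
    (hG : F.nonMemberSubfamily c = {Z}) :
    ∃ σ : Equiv.Perm ℕ, (Icc 1 n).image σ = Icc 1 n ∧
      ∀ A ∈ F, A.image σ ∈ familyM n k (k + 1) := by
  have hZ : Z ∈ F ∧ c ∉ Z := mem_nonMemberSubfamily.1 (hG ▸ mem_singleton_self Z)
  have hZV := mem_powersetCard.1 (hF hZ.1)
  obtain ⟨σ, hσ, hσ1, hσ2, -, -⟩ := exists_perm (V := Icc 1 n) (P := {c}) (Q := Z) (R := ∅)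
    (T := ∅) (P' := {1}) (Q' := Icc 2 (k + 1)) (R' := ∅) (T' := ∅)
    (singleton_subset_iff.2 hc) hZV.1 (empty_subset _) (empty_subset _)
    (disjoint_singleton_left.2 hZ.2) (disjoint_empty_right _) (disjoint_empty_right _)
    (disjoint_empty_right _) (disjoint_empty_right _) (disjoint_empty_right _)
    (by simp; omega) (Icc_subset_Icc (by omega) (by omega)) (empty_subset _) (empty_subset _)
    (by simp) (disjoint_empty_right _) (disjoint_empty_right _)
    (disjoint_empty_right _) (disjoint_empty_right _) (disjoint_empty_right _)
    (by simp) (by rw [hZV.2]; simp) rfl rfl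
  simp only [mem_singleton] at hσ1
  have himage : ∀ {A : Finset ℕ} {a : ℕ}, σ a ∈ A.image σ ↔ a ∈ A := by
    intro A a
    exact σ.injective.mem_finset_image
  have hc1 : ∀ A : Finset ℕ, 1 ∈ A.image σ ↔ c ∈ A := fun A => by
    rw [← (hσ1 c).2 rfl, himage]
  refine ⟨σ, hσ, fun A hA => ?_⟩
  have hAV := mem_powersetCard.1 (hF hA)
  rw [familyM, mem_filter, mem_powersetCard, card_image_of_injective _ σ.injective, hc1]
  refine ⟨⟨?_, hAV.2⟩, ?_⟩
  · rw [← hσ]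
    exact image_subset_image hAV.1
  by_cases hcA : c ∈ A
  · left
    refine ⟨hcA, ?_⟩
    obtain ⟨a, haA, haZ⟩ := not_disjoint_iff.1 (h A hA Z hZ.1)
    exact ⟨σ a, mem_inter.2 ⟨himage.2 haA, (hσ2 a).2 haZ⟩⟩
  · right
    refine ⟨hcA, fun b hb => ?_⟩
    have hAZ : A = Z := mem_singleton.1 (hG ▸ mem_nonMemberSubfamily.2 ⟨hA, hcA⟩)
    rw [← σ.apply_symm_apply b] at hb ⊢
    rw [himage, hAZ]
    exact (hσ2 _).1 hb

/-- A family whose members avoiding `c` are two neighbours is contained in a copy of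
`familyMkj n k 2`. -/
lemma exists_perm_familyMkj {n k c : ℕ} (hk : 2 ≤ k) (hn : k + 1 < n) {F : Finset (Finset ℕ)}
    {Y Z : Finset ℕ} (hF : F ⊆ (Icc 1 n).powersetCard k) (h : Cross F F) (hc : c ∈ Icc 1 n)
    (hYZ : Y ≠ Z) (hG : F.nonMemberSubfamily c = {Y, Z}) (hcard : #(Y \ Z) ≤ 1) :
    ∃ σ : Equiv.Perm ℕ, (Icc 1 n).image σ = Icc 1 n ∧
      F.image (fun A => A.image σ) ⊆ familyMkj n k 2 := by
  have hY : Y ∈ F ∧ c ∉ Y := mem_nonMemberSubfamily.1 (hG ▸ mem_insert_self Y {Z})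
  have hZ : Z ∈ F ∧ c ∉ Z :=
    mem_nonMemberSubfamily.1 (hG ▸ mem_insert_of_mem (mem_singleton_self Z))
  have hYV := mem_powersetCard.1 (hF hY.1)
  have hZV := mem_powersetCard.1 (hF hZ.1)
  have hcomm : #(Y \ Z) = #(Z \ Y) := card_sdiff_comm (hYV.2.trans hZV.2.symm)
  have hone : #(Y \ Z) = 1 := by
    refine le_antisymm hcard (card_pos.2 ?_)
    rw [nonempty_iff_ne_empty, Ne, sdiff_eq_empty_iff_subset]
    exact fun hsub => hYZ (eq_of_subset_of_card_le hsub (hZV.2.trans hYV.2.symm).le)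
  obtain ⟨y, hy⟩ := card_eq_one.1 hone
  obtain ⟨z, hz⟩ := card_eq_one.1 (hcomm ▸ hone)
  have hinter := card_inter_add_card_sdiff Y Z
  rw [hYV.2, hone] at hinter
  have hy' : y ∈ Y ∧ y ∉ Z := mem_sdiff.1 (hy ▸ mem_singleton_self y)
  have hz' : z ∈ Z ∧ z ∉ Y := mem_sdiff.1 (hz ▸ mem_singleton_self z)
  have hyz : y ≠ z := fun h => hy'.2 (h ▸ hz'.1)
  have hcy : c ≠ y := fun h => hY.2 (h ▸ hy'.1)
  have hcz : c ≠ z := fun h => hZ.2 (h ▸ hz'.1)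
  obtain ⟨σ, hσ, hσ1, hσ2, hσ3, hσ4⟩ := exists_perm (V := Icc 1 n) (P := {c}) (Q := Y ∩ Z)
    (R := {y}) (T := {z}) (P' := {1}) (Q' := Icc 2 k) (R' := {k + 1}) (T' := {k + 2})
    (singleton_subset_iff.2 hc) (inter_subset_left.trans hYV.1)
    (singleton_subset_iff.2 (hYV.1 hy'.1)) (singleton_subset_iff.2 (hZV.1 hz'.1))
    (by simp [hY.2]) (by simp [hcy]) (by simp [hcz]) (by simp [hy'.2]) (by simp [hz'.2])
    (by simp [hyz])
    (by simp; omega) (Icc_subset_Icc (by omega) (by omega)) (by simp; omega) (by simp; omega)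
    (by simp) (by simp; omega) (by simp) (by simp) (by simp) (by simp)
    (by simp) (by simp; omega) (by simp) (by simp)
  simp only [mem_singleton] at hσ1 hσ3 hσ4
  have himage : ∀ {A : Finset ℕ} {a : ℕ}, σ a ∈ A.image σ ↔ a ∈ A := by
    intro A a
    exact σ.injective.mem_finset_image
  have hc1 : σ c = 1 := (hσ1 c).2 rfl
  have hyk : σ y = k + 1 := (hσ3 y).2 rfl
  have hzk : σ z = k + 2 := (hσ4 z).2 rfl
  have hI : (Y ∩ Z).image σ = Icc 2 k := by
    ext b
    rw [← σ.apply_symm_apply b, himage, hσ2]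
  refine ⟨σ, hσ, fun B hB => ?_⟩
  obtain ⟨A, hA, rfl⟩ := mem_image.1 hB
  have hAV := mem_powersetCard.1 (hF hA)
  rw [mem_familyMkj, mem_powersetCard, card_image_of_injective _ σ.injective, ← hyk, ← hzk, ← hI,
    disjoint_image σ.injective, image_subset_image_iff σ.injective, himage, himage]
  refine ⟨⟨hσ ▸ image_subset_image hAV.1, hAV.2⟩, ?_⟩
  rw [← hc1, himage]
  by_cases hcA : c ∈ A
  · by_cases hd : Disjoint A (Y ∩ Z)
    · right
      left
      refine ⟨hcA, hd, ?_, ?_⟩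
      · obtain ⟨a, haA, haY⟩ := not_disjoint_iff.1 (h A hA Y hY.1)
        have haZ : a ∉ Z := fun haZ => disjoint_left.1 hd haA (mem_inter.2 ⟨haY, haZ⟩)
        have := hy ▸ mem_sdiff.2 ⟨haY, haZ⟩
        exact mem_singleton.1 this ▸ haA
      · obtain ⟨a, haA, haZ⟩ := not_disjoint_iff.1 (h A hA Z hZ.1)
        have haY : a ∉ Y := fun haY => disjoint_left.1 hd haA (mem_inter.2 ⟨haY, haZ⟩)
        have := hz ▸ mem_sdiff.2 ⟨haZ, haY⟩
        exact mem_singleton.1 this ▸ haA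
    · exact Or.inl ⟨hcA, hd⟩
  · right
    right
    have hAG : A ∈ F.nonMemberSubfamily c := mem_nonMemberSubfamily.2 ⟨hA, hcA⟩
    rw [hG, mem_insert, mem_singleton] at hAG
    rcases hAG with rfl | rfl
    · exact ⟨hcA, inter_subset_left, Or.inl ⟨hy'.1, hz'.2⟩⟩
    · exact ⟨hcA, inter_subset_right, Or.inr ⟨hy'.2, hz'.1⟩⟩

/-- A family attaining the bound is a copy of `familyMkj n k 2`. -/
lemma exists_perm_of_card_eq {n k : ℕ} (hk : 5 ≤ k) (hn : 2 * k < n) {F : Finset (Finset ℕ)}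
    (hF : F ⊆ (Icc 1 n).powersetCard k) (h : Cross F F)
    (h2 : ∀ c ∈ Icc 1 n, 2 ≤ #(F.nonMemberSubfamily c))
    (hcard : #F + (n - k - 1).choose (k - 1) + (n - k - 2).choose (k - 2) =
      (n - 1).choose (k - 1) + 2) :
    ∃ σ : Equiv.Perm ℕ, (Icc 1 n).image σ = Icc 1 n ∧
      F.image (fun A => A.image σ) = familyMkj n k 2 := by
  have hV : #(Icc 1 n) = n := by simp
  have hlt := (bound_of_two_le hk (by rwa [hV]) (V := Icc 1 n) _ F rfl hF h h2).2
  rw [hV] at hlt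
  obtain ⟨c, hc, hG⟩ : ∃ c ∈ Icc 1 n, #(F.nonMemberSubfamily c) = 2 := by
    by_contra! hne
    have := hlt fun c hc => by
      have := h2 c hc
      have := hne c hc
      omega
    omega
  obtain ⟨Y, Z, hYZ, hYZG⟩ := card_eq_two.1 hG
  have hone : #(Y \ Z) ≤ 1 := card_sdiff_le_one hk (by rwa [hV]) hF h hc hG (by simp [hYZG])
    (by simp [hYZG]) (by rwa [hV])
  obtain ⟨σ, hσ, hsub⟩ := exists_perm_familyMkj (by omega) (by omega) hF h hc hYZ hYZG hone
  refine ⟨σ, hσ, eq_of_subset_of_card_le hsub ?_⟩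
  have := card_familyMkj hk hn
  rw [card_image_of_injective _ (image_injective σ.injective)]
  omega

end IntersectingFamily

theorem Han_Kohayakawa (n k : ℕ) (hk : 5 ≤ k) (hn : 2 * k < n)
    (F : Finset (Finset ℕ))
    (hF : ∀ A ∈ F, A ∈ (Finset.Icc 1 n).powersetCard k)
    (hint : ∀ A ∈ F, ∀ B ∈ F, (A ∩ B).Nonempty)
    (hnostar : ¬ ∃ p, ∀ A ∈ F, p ∈ A)
    (hnoHM : ∀ σ : Equiv.Perm ℕ, (Finset.Icc 1 n).image σ = Finset.Icc 1 n →
      ¬ ∀ A ∈ F, A.image σ ∈ familyM n k (k + 1)) :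
    F.card ≤ (n - 1).choose (k - 1) - (n - k - 1).choose (k - 1) - (n - k - 2).choose (k - 2) + 2 ∧
    (F.card = (n - 1).choose (k - 1) - (n - k - 1).choose (k - 1) - (n - k - 2).choose (k - 2) + 2 ↔
      ∃ σ : Equiv.Perm ℕ, (Finset.Icc 1 n).image σ = Finset.Icc 1 n ∧
        F.image (fun A => A.image σ) = familyMkj n k 2) := by
  have hV : #(Icc 1 n) = n := by simp
  have h : IntersectingFamily.Cross F F := fun X hX Y hY =>
    not_disjoint_iff_nonempty_inter.2 (hint X hX Y hY)
  have h2 : ∀ c ∈ Icc 1 n, 2 ≤ #(F.nonMemberSubfamily c) := by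
    intro c hc
    by_contra! hlt
    rcases Nat.lt_succ_iff_lt_or_eq.1 hlt with h0 | h1
    · have hempty := card_eq_zero.1 (Nat.lt_one_iff.1 h0)
      refine hnostar ⟨c, fun A hA => ?_⟩
      by_contra hcA
      exact notMem_empty A (hempty ▸ mem_nonMemberSubfamily.2 ⟨hA, hcA⟩)
    · obtain ⟨Z, hZ⟩ := card_eq_one.1 h1
      obtain ⟨σ, hσ, hsub⟩ := IntersectingFamily.exists_perm_familyM (by omega) (by omega) hF h
        hc hZ
      exact hnoHM σ hσ hsub
  have hbound := (IntersectingFamily.bound_of_two_le hk (by rwa [hV]) (V := Icc 1 n) _ F rfl hF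
    h h2).1
  rw [hV] at hbound
  have hM := IntersectingFamily.card_familyMkj hk hn
  have hF2 : 2 ≤ #F :=
    (h2 1 (mem_Icc.2 ⟨le_rfl, by omega⟩)).trans (card_le_card (filter_subset _ _))
  refine ⟨by omega, fun hcard => ?_, ?_⟩
  · exact IntersectingFamily.exists_perm_of_card_eq hk hn hF h h2 (by omega)
  · rintro ⟨σ, -, hσ⟩
    rw [← hσ, card_image_of_injective _ (image_injective σ.injective)] at hM
    omega
end

section
/- Let n > 2k and 3 ≤ i ≤ k+1. If F ⊆ ([n] choose k) is an intersecting family with maximum degree d_max(F) ≤ d_max(M_i) = Σ_{j=2}^{i} C(n-j, k-2), then |F| ≤ |M_i| = Σ_{j=2}^{i} C(n-j,k-2) + C(n-i,k-i+1). -/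
open Finset
open scoped FinsetFamily

/-- The normalized matching property of the Boolean lattice. -/
lemma card_mul_choose_le_card_mul_choose {α : Type*} [DecidableEq α] {X : Finset α}
    {S T : Finset (Finset α)} {a c : ℕ} (hac : a ≤ c) (hT : ∀ t ∈ T, t ⊆ X ∧ #t = c)
    (hST : ∀ t ∈ T, ∀ s ⊆ t, #s = a → s ∈ S) :
    #T * (#X).choose a ≤ #S * (#X).choose c := by
  obtain rfl | ⟨t₀, ht₀⟩ := T.eq_empty_or_nonempty
  · simp
  have hcX : c ≤ #X := by
    rw [← (hT t₀ ht₀).2]; exact card_le_card (hT t₀ ht₀).1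
  set S' := {s ∈ S | #s = a ∧ s ⊆ X} with hS'
  have hcount : #T * c.choose a ≤ #S' * (#X - a).choose (c - a) := by
    refine card_mul_le_card_mul (fun t s => s ⊆ t) (fun t ht => ?_) (fun s hs => ?_)
    · rw [← (hT t ht).2, ← card_powersetCard]
      refine card_le_card fun s hs => ?_
      rw [mem_powersetCard] at hs
      simp only [mem_bipartiteAbove, hS', mem_filter]
      exact ⟨⟨hST t ht s hs.1 hs.2, hs.2, hs.1.trans (hT t ht).1⟩, hs.1⟩
    · rw [hS', mem_filter] at hs
      rw [← hs.2.1, ← card_sdiff_of_subset hs.2.2, ← card_powersetCard]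
      refine card_le_card_of_injOn (fun t => t \ s) (fun t ht => ?_) fun t ht u hu htu => ?_
      · simp only [mem_coe, mem_bipartiteBelow] at ht
        simp only [mem_coe, mem_powersetCard]
        refine ⟨sdiff_subset_sdiff (hT t ht.1).1 le_rfl, ?_⟩
        rw [card_sdiff_of_subset ht.2, (hT t ht.1).2]
      · simp only [mem_coe, mem_bipartiteBelow] at ht hu
        rw [← sdiff_union_of_subset ht.2, ← sdiff_union_of_subset hu.2]
        exact congrArg (· ∪ s) htu
  have hpos : 0 < c.choose a := Nat.choose_pos hac
  have hmul := Nat.choose_mul (n := #X) hac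
  have hSS : #S' ≤ #S := card_le_card (filter_subset _ _)
  refine Nat.le_of_mul_le_mul_right ?_ hpos
  calc #T * (#X).choose a * c.choose a = #T * c.choose a * (#X).choose a := by ring
    _ ≤ #S' * (#X - a).choose (c - a) * (#X).choose a := by gcongr
    _ = #S' * ((#X).choose c * c.choose a) := by rw [hmul]; ring
    _ ≤ #S * (#X).choose c * c.choose a := by rw [← mul_assoc]; gcongr

/-- The set of the `x` smallest elements of `Fin m`. -/
def finInit (m x : ℕ) : Finset (Fin m) := {p | p.val < x}

lemma card_finInit {m x : ℕ} (h : x ≤ m) : #(finInit m x) = x := by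
  rw [finInit, Fin.card_filter_val_lt, min_eq_right h]

lemma isInitSeg_powersetCard_finInit (m x c : ℕ) :
    Colex.IsInitSeg (powersetCard c (finInit m x)) c := by
  refine ⟨Set.sized_powersetCard _ _, ?_⟩
  simp_rw [mem_powersetCard]
  rintro A B hA ⟨HB₁, HB₂⟩
  refine ⟨fun t ht ↦ ?_, HB₂⟩
  simp only [finInit, mem_filter, mem_univ, true_and]
  have : toColex (image Fin.val B) < toColex (image Fin.val A) := by
    rwa [Colex.toColex_image_lt_toColex_image Fin.val_strictMono]
  apply Colex.forall_lt_mono this.le _ t (mem_image.2 ⟨t, ht, rfl⟩)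
  simp_rw [mem_image]
  rintro _ ⟨a, ha, rfl⟩
  simpa [finInit] using hA.1 ha

lemma exists_isInitSeg_card_eq (m c q : ℕ) (hq : q ≤ m.choose c) :
    ∃ 𝒞 : Finset (Finset (Fin m)), Colex.IsInitSeg 𝒞 c ∧ #𝒞 = q := by
  induction q with
  | zero => exact ⟨∅, by simp, rfl⟩
  | succ q ih =>
    obtain ⟨𝒞, h𝒞, rfl⟩ := ih (by omega)
    have hne : (powersetCard c (univ : Finset (Fin m)) \ 𝒞).Nonempty := by
      rw [← card_pos]
      have := le_card_sdiff 𝒞 (powersetCard c (univ : Finset (Fin m)))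
      rw [card_powersetCard, card_univ, Fintype.card_fin] at this
      omega
    obtain ⟨B, hB, hmin⟩ := exists_min_image _ toColex hne
    rw [mem_sdiff, mem_powersetCard] at hB
    refine ⟨insert B 𝒞, ⟨?_, ?_⟩, card_insert_of_notMem hB.2⟩
    · intro s hs
      rw [mem_coe, mem_insert] at hs
      obtain rfl | hs := hs
      · exact hB.1.2
      · exact h𝒞.1 hs
    · rintro s t hs ⟨hts, ht⟩
      rw [mem_insert] at hs ⊢
      right
      obtain rfl | hs := hs
      · by_contra htC
        exact (hmin t (by simp [ht, htC])).not_gt hts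
      · exact h𝒞.2 hs ⟨hts, ht⟩

/-- A form of the Kruskal–Katona theorem interpolating between consecutive binomials. -/
lemma sub_choose_mul_le_shadow_iterate {m x a j : ℕ} {C : Finset (Finset (Fin m))}
    (hC : (C : Set (Finset (Fin m))).Sized (a + 1 + j)) (hcx : a + 1 + j ≤ x) (hxm : x < m)
    (hlo : x.choose (a + 1 + j) ≤ #C) (hhi : #C ≤ (x + 1).choose (a + 1 + j)) :
    ((#C : ℤ) - x.choose (a + 1 + j)) * x.choose a ≤
      ((#(∂^[j] C) : ℤ) - x.choose (a + 1)) * x.choose (a + j) := by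
  have hle : (x + 1).choose (a + 1 + j) ≤ m.choose (a + 1 + j) := Nat.choose_le_choose _ hxm
  obtain ⟨𝒞, h𝒞, hcard⟩ := exists_isInitSeg_card_eq m (a + 1 + j) #C (hhi.trans hle)
  have hkk : #(∂^[j] 𝒞) ≤ #(∂^[j] C) := iterated_kk hC hcard.le h𝒞
  have hsub : powersetCard (a + 1 + j) (finInit m x) ⊆ 𝒞 := by
    obtain h | h := (isInitSeg_powersetCard_finInit m x (a + 1 + j)).total h𝒞
    · exact h
    · rw [eq_of_subset_of_card_le h]
      rw [card_powersetCard, card_finInit hxm.le, hcard]; exact hlo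
  have hsup : 𝒞 ⊆ powersetCard (a + 1 + j) (finInit m (x + 1)) := by
    obtain h | h := h𝒞.total (isInitSeg_powersetCard_finInit m (x + 1) (a + 1 + j))
    · exact h
    · rw [eq_of_subset_of_card_le h]
      rw [card_powersetCard, card_finInit hxm, hcard]; exact hhi
  set p : Fin m := ⟨x, hxm⟩ with hp
  have hpx : p ∉ finInit m x := by simp [finInit, hp]
  have hdown : ∀ s : Finset (Fin m), s ⊆ finInit m (x + 1) → p ∉ s → s ⊆ finInit m x := by
    intro s hs hps q hq
    have h1 := hs hq
    have h2 : q ≠ p := by rintro rfl; exact hps hq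
    simp only [finInit, mem_filter, mem_univ, true_and] at h1 ⊢
    have h3 : q.val ≠ x := fun h => h2 (Fin.ext h)
    omega
  have hnon : 𝒞.nonMemberSubfamily p = powersetCard (a + 1 + j) (finInit m x) := by
    ext s
    rw [mem_nonMemberSubfamily, mem_powersetCard]
    constructor
    · rintro ⟨hs, hps⟩
      exact ⟨hdown s (mem_powersetCard.1 (hsup hs)).1 hps, h𝒞.1 hs⟩
    · rintro ⟨hs, hsc⟩
      exact ⟨hsub (mem_powersetCard.2 ⟨hs, hsc⟩), fun h => hpx (hs h)⟩
  have hmem : ∀ t ∈ 𝒞.memberSubfamily p, t ⊆ finInit m x ∧ #t = a + j := by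
    intro t ht
    rw [mem_memberSubfamily] at ht
    have h1 := mem_powersetCard.1 (hsup ht.1)
    refine ⟨hdown t ((subset_insert _ _).trans h1.1) ht.2, ?_⟩
    have := h1.2
    rw [card_insert_of_notMem ht.2] at this
    omega
  have hmatch := card_mul_choose_le_card_mul_choose (a := a) (S := (∂^[j] 𝒞).memberSubfamily p)
    (by omega) hmem (fun t ht s hst hs => by
      rw [mem_memberSubfamily] at ht ⊢
      have hps : p ∉ s := fun h => ht.2 (hst h)
      refine ⟨mem_shadow_iterate_iff_exists_mem_card_add.2
        ⟨_, ht.1, insert_subset_insert _ hst, ?_⟩, hps⟩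
      rw [h𝒞.1 ht.1, card_insert_of_notMem hps, hs])
  have hnonD : powersetCard (a + 1) (finInit m x) ⊆ (∂^[j] 𝒞).nonMemberSubfamily p := by
    intro s hs
    rw [mem_powersetCard] at hs
    rw [mem_nonMemberSubfamily]
    refine ⟨mem_shadow_iterate_iff_exists_mem_card_add.2 ?_, fun h => hpx (hs.1 h)⟩
    obtain ⟨t, hst, htx, ht⟩ := exists_subsuperset_card_eq (n := a + 1 + j) hs.1 (by omega)
      (by rw [card_finInit hxm.le]; exact hcx)
    exact ⟨t, hsub (mem_powersetCard.2 ⟨htx, ht⟩), hst, by omega⟩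
  have h1 := card_memberSubfamily_add_card_nonMemberSubfamily p 𝒞
  have h2 := card_memberSubfamily_add_card_nonMemberSubfamily p (∂^[j] 𝒞)
  have h3 := card_le_card hnonD
  rw [hnon, card_powersetCard, card_finInit hxm.le] at h1
  rw [card_powersetCard, card_finInit hxm.le] at h3
  rw [card_finInit hxm.le] at hmatch
  have e1 : ((#C : ℤ) - x.choose (a + 1 + j)) = #(𝒞.memberSubfamily p) := by omega
  have e2 : (#((∂^[j] 𝒞).memberSubfamily p) : ℤ) ≤ (#(∂^[j] C) : ℤ) - x.choose (a + 1) := by omega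
  rw [e1]
  calc (#(𝒞.memberSubfamily p) : ℤ) * x.choose a
      ≤ #((∂^[j] 𝒞).memberSubfamily p) * x.choose (a + j) := by exact_mod_cast hmatch
    _ ≤ _ := by gcongr

/-- The excess of the shadow over the family is at least its minimum over binomial sizes. -/
lemma card_add_le_card_shadow_iterate {m a j lo hi : ℕ} {C : Finset (Finset (Fin m))} {T : ℤ}
    (hC : (C : Set (Finset (Fin m))).Sized (a + 1 + j)) (hclo : a + 1 + j ≤ lo) (hlohi : lo < hi)
    (hhim : hi ≤ m) (hlo : lo.choose (a + 1 + j) ≤ #C) (hhi : #C ≤ hi.choose (a + 1 + j))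
    (hT : ∀ x, lo ≤ x → x ≤ hi → T ≤ (x.choose (a + 1) : ℤ) - x.choose (a + 1 + j)) :
    #C + T ≤ #(∂^[j] C) := by
  obtain ⟨x, hx1, hx2, hx3, hx4⟩ : ∃ x, lo ≤ x ∧ x < hi ∧ x.choose (a + 1 + j) ≤ #C ∧
      #C ≤ (x + 1).choose (a + 1 + j) := by
    have key : ∀ d, lo + d ≤ hi → lo < lo + d → #C ≤ (lo + d).choose (a + 1 + j) →
        ∃ x, lo ≤ x ∧ x < hi ∧ x.choose (a + 1 + j) ≤ #C ∧
          #C ≤ (x + 1).choose (a + 1 + j) := by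
      intro d
      induction d with
      | zero => intro _ h; omega
      | succ d ih =>
        intro h1 _ h3
        by_cases h : (lo + d).choose (a + 1 + j) ≤ #C
        · exact ⟨lo + d, by omega, by omega, h, h3⟩
        · have : d ≠ 0 := by rintro rfl; exact h hlo
          exact ih (by omega) (by omega) (by omega)
    obtain ⟨d, rfl⟩ := Nat.exists_eq_add_of_lt hlohi
    exact key (d + 1) (by omega) (by omega) hhi
  have hmain := sub_choose_mul_le_shadow_iterate hC (by omega) (by omega) hx3 hx4
  have t1 := hT x hx1 hx2.le
  have t2 := hT (x + 1) (by omega) hx2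
  have p1 : (x + 1).choose (a + 1) = x.choose a + x.choose (a + 1) := Nat.choose_succ_succ _ _
  have p2 : (x + 1).choose (a + 1 + j) = x.choose (a + j) + x.choose (a + 1 + j) := by
    rw [show a + 1 + j = a + j + 1 by ring]; exact Nat.choose_succ_succ _ _
  have hpos : 0 < x.choose (a + j) := Nat.choose_pos (by omega)
  rw [p1, p2] at t2
  rw [p2] at hx4
  push_cast at t2
  zify at hx3 hx4 hpos
  set r : ℤ := (#C : ℤ) - x.choose (a + 1 + j)
  set u : ℤ := (#(∂^[j] C) : ℤ) - x.choose (a + 1) with hu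
  set p : ℤ := ((x.choose a : ℕ) : ℤ)
  set q : ℤ := ((x.choose (a + j) : ℕ) : ℤ)
  set g : ℤ := (x.choose (a + 1) : ℤ) - x.choose (a + 1 + j)
  have hr0 : 0 ≤ r := by omega
  have hrq : r ≤ q := by omega
  have hg : T ≤ g := t1
  have hg' : T ≤ g + (p - q) := by omega
  suffices T ≤ g + (u - r) by omega
  refine le_of_mul_le_mul_left ?_ hpos
  nlinarith [mul_nonneg hr0 (sub_nonneg.2 hg'), mul_nonneg (sub_nonneg.2 hrq) (sub_nonneg.2 hg)]

lemma choose_le_choose_of_add_le {M p q : ℕ} (hqp : q ≤ p) (h : p + q ≤ M) :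
    M.choose q ≤ M.choose p := by
  have mono : ∀ p, q ≤ p → 2 * p ≤ M → M.choose q ≤ M.choose p := by
    intro p hp
    induction p, hp using Nat.le_induction with
    | base => intro _; rfl
    | succ p hp ih =>
      intro h
      exact (ih (by omega)).trans (Nat.choose_le_succ_of_lt_half_left (by omega))
  by_cases hp : 2 * p ≤ M
  · exact mono p hqp hp
  · rw [← Nat.choose_symm (show p ≤ M by omega)]
    exact mono _ (by omega) (by omega)

lemma choose_le_choose_of_le_add {M p q : ℕ} (hpq : p ≤ q) (h : M ≤ p + q) :
    M.choose q ≤ M.choose p := by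
  by_cases hq : q ≤ M
  · rw [← Nat.choose_symm hq, ← Nat.choose_symm (hpq.trans hq)]
    exact choose_le_choose_of_add_le (by omega) (by omega)
  · rw [Nat.choose_eq_zero_of_lt (by omega)]
    exact Nat.zero_le _

lemma card_add_card_add_le_choose_fin {m a b j lo hi : ℕ} {T : ℤ} {A B : Finset (Finset (Fin m))}
    (hm : m = a + 1 + j + b) (hA : (A : Set (Finset (Fin m))).Sized (a + 1))
    (hB : (B : Set (Finset (Fin m))).Sized b)
    (hAB : ∀ s ∈ A, ∀ t ∈ B, (s ∩ t).Nonempty) (hclo : a + 1 + j ≤ lo) (hlohi : lo < hi)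
    (hhim : hi ≤ m) (hlo : lo.choose (a + 1 + j) ≤ #B) (hhi : #B ≤ hi.choose (a + 1 + j))
    (hT : ∀ x, lo ≤ x → x ≤ hi → T ≤ (x.choose (a + 1) : ℤ) - x.choose (a + 1 + j)) :
    (#A + #B + T : ℤ) ≤ m.choose (a + 1) := by
  have hC : (Bᶜˢ : Set (Finset (Fin m))).Sized (a + 1 + j) := by
    have := hB.compls
    rw [Fintype.card_fin, show m - b = a + 1 + j by omega] at this
    exact this
  rw [← card_compls] at hlo hhi
  have h := card_add_le_card_shadow_iterate hC hclo hlohi hhim hlo hhi hT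
  have hdisj : Disjoint A (∂^[j] Bᶜˢ) := by
    rw [disjoint_right]
    intro s hs hsA
    obtain ⟨t, ht, hst, -⟩ := mem_shadow_iterate_iff_exists_sdiff.1 hs
    obtain ⟨v, hv⟩ := hAB s hsA _ (mem_compls.1 ht)
    rw [mem_inter, mem_compl] at hv
    exact hv.2 (hst hv.1)
  have hsize : ((A ∪ ∂^[j] Bᶜˢ : Finset (Finset (Fin m))) : Set (Finset (Fin m))).Sized
      (a + 1) := by
    rw [coe_union, Set.sized_union]
    refine ⟨hA, ?_⟩
    have := hC.shadow_iterate (k := j)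
    rwa [Nat.add_sub_cancel] at this
  have hcard := hsize.card_le
  rw [card_union_of_disjoint hdisj, Fintype.card_fin] at hcard
  rw [card_compls] at h
  have : (#A + #(∂^[j] Bᶜˢ) : ℤ) ≤ m.choose (a + 1) := by exact_mod_cast hcard
  linarith

/-- A bound on the sum of the sizes of cross-intersecting families, one of which has restricted
size. -/
lemma card_add_card_add_le_choose {a b j lo hi : ℕ} {T : ℤ} {X : Finset ℕ}
    {A B : Finset (Finset ℕ)} (hm : #X = a + 1 + j + b)
    (hA : ∀ s ∈ A, s ⊆ X ∧ #s = a + 1) (hB : ∀ s ∈ B, s ⊆ X ∧ #s = b)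
    (hAB : ∀ s ∈ A, ∀ t ∈ B, (s ∩ t).Nonempty) (hclo : a + 1 + j ≤ lo) (hlohi : lo < hi)
    (hhim : hi ≤ #X) (hlo : lo.choose (a + 1 + j) ≤ #B) (hhi : #B ≤ hi.choose (a + 1 + j))
    (hT : ∀ x, lo ≤ x → x ≤ hi → T ≤ (x.choose (a + 1) : ℤ) - x.choose (a + 1 + j)) :
    (#A + #B + T : ℤ) ≤ (#X).choose (a + 1) := by
  set e : Fin #X ↪ ℕ := (X.orderEmbOfFin rfl).toEmbedding with he
  set pull : Finset ℕ → Finset (Fin #X) := fun s => {i | e i ∈ s} with hpull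
  have hmap : ∀ s ⊆ X, (pull s).map e = s := by
    intro s hs
    ext v
    simp only [hpull, mem_map, mem_filter, mem_univ, true_and]
    constructor
    · rintro ⟨i, hi, rfl⟩; exact hi
    · intro hv
      have : v ∈ Set.range (X.orderEmbOfFin rfl) := by
        rw [range_orderEmbOfFin]; exact hs hv
      obtain ⟨i, rfl⟩ := this
      exact ⟨i, hv, rfl⟩
  have hinj : ∀ C : Finset (Finset ℕ), (∀ s ∈ C, s ⊆ X) → #(C.image pull) = #C := by
    intro C hC
    refine card_image_of_injOn fun s hs t ht hst => ?_
    rw [← hmap s (hC s hs), ← hmap t (hC t ht)]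
    exact congrArg (Finset.map e) hst
  have hcard : ∀ s ⊆ X, #(pull s) = #s := fun s hs => by
    rw [← card_map e, hmap s hs]
  have hsized : ∀ (C : Finset (Finset ℕ)) (r : ℕ), (∀ s ∈ C, s ⊆ X ∧ #s = r) →
      (C.image pull : Set (Finset (Fin #X))).Sized r := by
    intro C r hC s hs
    obtain ⟨t, ht, rfl⟩ := mem_image.1 (mem_coe.1 hs)
    rw [hcard t (hC t ht).1, (hC t ht).2]
  rw [← hinj A fun s hs => (hA s hs).1, ← hinj B fun s hs => (hB s hs).1]
  rw [← hinj B fun s hs => (hB s hs).1] at hlo hhi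
  refine card_add_card_add_le_choose_fin hm (hsized A _ hA) (hsized B _ hB) ?_ hclo hlohi hhim
    hlo hhi hT
  simp only [forall_mem_image]
  intro s hs t ht
  obtain ⟨v, hv⟩ := hAB s hs t ht
  rw [mem_inter] at hv
  have hvs := hv.1
  rw [← hmap s (hA s hs).1, mem_map] at hvs
  obtain ⟨i, hi, rfl⟩ := hvs
  refine ⟨i, mem_inter.2 ⟨hi, ?_⟩⟩
  simpa [hpull] using hv.2

/-- The bound for cross-intersecting families in the range where it decreases. -/
lemma card_add_card_add_choose_le {a b j lo hi : ℕ} {X : Finset ℕ} {A B : Finset (Finset ℕ)}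
    (hm : #X = a + 1 + j + b)
    (hA : ∀ s ∈ A, s ⊆ X ∧ #s = a + 1) (hB : ∀ s ∈ B, s ⊆ X ∧ #s = b)
    (hAB : ∀ s ∈ A, ∀ t ∈ B, (s ∩ t).Nonempty) (hclo : a + 1 + j ≤ lo) (hlohi : lo < hi)
    (hhim : hi ≤ #X) (hhia : hi ≤ 2 * a + 1 + j)
    (hlo : lo.choose (a + 1 + j) ≤ #B) (hhi : #B ≤ hi.choose (a + 1 + j)) :
    #A + #B + lo.choose (a + 1) ≤ (#X).choose (a + 1) + lo.choose (a + 1 + j) := by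
  have hmono : ∀ x, lo ≤ x → x ≤ hi → (lo.choose (a + 1) : ℤ) - lo.choose (a + 1 + j) ≤
      (x.choose (a + 1) : ℤ) - x.choose (a + 1 + j) := by
    intro x hx
    induction x, hx using Nat.le_induction with
    | base => intro _; rfl
    | succ x hx ih =>
      intro h
      have h1 := ih (by omega)
      have h2 : x.choose (a + j) ≤ x.choose a := choose_le_choose_of_le_add (by omega) (by omega)
      have p1 : (x + 1).choose (a + 1) = x.choose a + x.choose (a + 1) := Nat.choose_succ_succ _ _
      have p2 : (x + 1).choose (a + 1 + j) = x.choose (a + j) + x.choose (a + 1 + j) := by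
        rw [show a + 1 + j = a + j + 1 by ring]; exact Nat.choose_succ_succ _ _
      rw [p1, p2]
      push_cast
      omega
  have := card_add_card_add_le_choose hm hA hB hAB hclo hlohi hhim hlo hhi hmono
  omega

/-- Balanced case: cross-intersecting families of `r`-sets, neither of them too small. -/
lemma card_add_card_le_two_mul_choose {r N : ℕ} {X : Finset ℕ} {A B : Finset (Finset ℕ)}
    (hr : 2 ≤ r) (hX : #X = N) (hN : 2 * r ≤ N)
    (hA : ∀ s ∈ A, s ⊆ X ∧ #s = r) (hB : ∀ s ∈ B, s ⊆ X ∧ #s = r)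
    (hAB : ∀ s ∈ A, ∀ t ∈ B, (s ∩ t).Nonempty)
    (hAlo : (N - 2).choose (r - 2) ≤ #A) (hBlo : (N - 2).choose (r - 2) ≤ #B) :
    #A + #B ≤ 2 * (N - 1).choose (r - 1) := by
  obtain ⟨r, rfl⟩ := Nat.exists_eq_add_of_le' hr
  obtain ⟨j, rfl⟩ := Nat.exists_eq_add_of_le hN
  have s1 : (2 * (r + 2) + j - 2).choose (r + 1 + 1 + j) = (2 * (r + 2) + j - 2).choose r := by
    rw [← Nat.choose_symm (by omega)]; congr 1; omega
  have s2 : (2 * (r + 2) + j - 1).choose (r + 1 + 1 + j) =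
      (2 * (r + 2) + j - 1).choose (r + 1) := by
    rw [← Nat.choose_symm (by omega)]; congr 1; omega
  have p1 : (2 * (r + 2) + j).choose (r + 2) =
      (2 * (r + 2) + j - 1).choose (r + 1) + (2 * (r + 2) + j - 1).choose (r + 2) := by
    rw [show 2 * (r + 2) + j = 2 * (r + 2) + j - 1 + 1 by omega]; exact Nat.choose_succ_succ _ _
  have p2 : (2 * (r + 2) + j - 1).choose (r + 2) =
      (2 * (r + 2) + j - 2).choose (r + 1) + (2 * (r + 2) + j - 2).choose (r + 2) := by
    rw [show 2 * (r + 2) + j - 1 = 2 * (r + 2) + j - 2 + 1 by omega]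
    exact Nat.choose_succ_succ _ _
  have p3 : (2 * (r + 2) + j - 1).choose (r + 1) =
      (2 * (r + 2) + j - 2).choose r + (2 * (r + 2) + j - 2).choose (r + 1) := by
    rw [show 2 * (r + 2) + j - 1 = 2 * (r + 2) + j - 2 + 1 by omega]
    exact Nat.choose_succ_succ _ _
  simp only [Nat.add_sub_cancel, show r + 2 - 1 = r + 1 by omega] at *
  have key : ∀ A B : Finset (Finset ℕ), (∀ s ∈ A, s ⊆ X ∧ #s = r + 2) →
      (∀ s ∈ B, s ⊆ X ∧ #s = r + 2) → (∀ s ∈ A, ∀ t ∈ B, (s ∩ t).Nonempty) →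
      (2 * (r + 2) + j - 2).choose r ≤ #B → #B ≤ (2 * (r + 2) + j - 1).choose (r + 1) →
      #A + #B ≤ 2 * (2 * (r + 2) + j - 1).choose (r + 1) := by
    intro A B hA hB hAB hlo hhi
    have h := card_add_card_add_choose_le (a := r + 1) (b := r + 2) (j := j)
      (lo := 2 * (r + 2) + j - 2) (hi := 2 * (r + 2) + j - 1) (by omega) hA hB hAB (by omega)
      (by omega) (by omega) (by omega) (by omega) (by omega)
    rw [hX, s1, show r + 1 + 1 = r + 2 from rfl] at h
    omega
  by_cases hBhi : #B ≤ (2 * (r + 2) + j - 1).choose (r + 1)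
  · exact key A B hA hB hAB hBlo hBhi
  · by_cases hAhi : #A ≤ (2 * (r + 2) + j - 1).choose (r + 1)
    · rw [add_comm]
      refine key B A hB hA (fun s hs t ht => ?_) hAlo hAhi
      rw [inter_comm]
      exact hAB t ht s hs
    · obtain ⟨B', hB'B, hB'⟩ := exists_subset_card_eq (le_of_not_ge hBhi)
      have := key A B' hA (fun s hs => hB s (hB'B hs)) (fun s hs t ht => hAB s hs t (hB'B ht))
        (by omega) hB'.le
      omega

/-- Cross-intersecting families of `r`-sets and of `(r + 2)`-sets, the latter of bounded size. -/
lemma card_add_card_le_choose {r N : ℕ} {X : Finset ℕ} {A B : Finset (Finset ℕ)}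
    (hr : 1 ≤ r) (hX : #X = N) (hN : 2 * r + 2 ≤ N)
    (hA : ∀ s ∈ A, s ⊆ X ∧ #s = r) (hB : ∀ s ∈ B, s ⊆ X ∧ #s = r + 2)
    (hAB : ∀ s ∈ A, ∀ t ∈ B, (s ∩ t).Nonempty)
    (hBhi : #B ≤ (N - 2).choose r) :
    #A + #B ≤ N.choose r := by
  obtain rfl | hne := B.eq_empty_or_nonempty
  · rw [card_empty, add_zero, ← hX, ← card_powersetCard]
    exact card_le_card fun s hs => mem_powersetCard.2 (hA s hs)
  obtain ⟨r, rfl⟩ := Nat.exists_eq_add_of_le' hr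
  obtain ⟨j, rfl⟩ := Nat.exists_eq_add_of_le hN
  have s1 : (2 * (r + 1) + 2 + j - 2).choose (r + 1 + j) =
      (2 * (r + 1) + 2 + j - 2).choose (r + 1) := by
    rw [← Nat.choose_symm (by omega)]; congr 1; omega
  have h := card_add_card_add_le_choose (a := r) (b := r + 1 + 2) (j := j) (T := 0)
      (lo := r + 1 + j) (hi := 2 * (r + 1) + 2 + j - 2) (by omega) hA hB hAB (by omega)
      (by omega) (by omega) (by rw [Nat.choose_self]; exact hne.card_pos) (by omega)
      (fun x _ hx => by
        have := choose_le_choose_of_le_add (M := x) (p := r + 1) (q := r + 1 + j) (by omega)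
          (by omega)
        omega)
  rw [hX] at h
  omega

lemma inter_nonempty_of_insert {s t : Finset ℕ} {x : ℕ} (hx : x ∉ t)
    (h : (insert x s ∩ t).Nonempty) : (s ∩ t).Nonempty := by
  obtain ⟨v, hv⟩ := h
  grind

/-- The bound for intersecting families in which some vertex is missed by an intermediate number
of members. -/
lemma card_add_choose_le {n k i x : ℕ} {F : Finset (Finset ℕ)} (hn : 2 * k < n) (hi4 : 4 ≤ i)
    (hik : i ≤ k + 1) (hF : ∀ A ∈ F, A ⊆ Icc 1 n ∧ #A = k)
    (hint : ∀ A ∈ F, ∀ B ∈ F, (A ∩ B).Nonempty) (hx : x ∈ Icc 1 n)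
    (hlo : (n - i).choose (k + 1 - i) ≤ #(F.nonMemberSubfamily x))
    (hhi : #(F.nonMemberSubfamily x) ≤ (n - 3).choose (k - 2)) :
    #F + (n - i).choose (k - 1) ≤ (n - 1).choose (k - 1) + (n - i).choose (k + 1 - i) := by
  have hX : #((Icc 1 n).erase x) = n - 1 := by rw [card_erase_of_mem hx]; simp
  have s1 : (n - i).choose (n - 1 - k) = (n - i).choose (k + 1 - i) := by
    rw [← Nat.choose_symm (by omega)]; congr 1; omega
  have s2 : (n - 3).choose (n - 1 - k) = (n - 3).choose (k - 2) := by
    rw [← Nat.choose_symm (by omega)]; congr 1; omega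
  rw [← s1] at hlo
  rw [← s2] at hhi
  have e1 : n - 1 - k = k - 2 + 1 + (n - 2 * k) := by omega
  rw [e1] at hlo hhi
  have h := card_add_card_add_choose_le (X := (Icc 1 n).erase x) (A := F.memberSubfamily x)
    (B := F.nonMemberSubfamily x) (a := k - 2) (b := k) (j := n - 2 * k) (lo := n - i)
    (hi := n - 3) (by omega) ?_ ?_ ?_ (by omega) (by omega) (by omega) (by omega) hlo hhi
  · rw [hX, ← e1, s1, card_memberSubfamily_add_card_nonMemberSubfamily,
      show k - 2 + 1 = k - 1 by omega] at h
    exact h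
  · intro s hs
    rw [mem_memberSubfamily] at hs
    have := hF _ hs.1
    rw [card_insert_of_notMem hs.2] at this
    exact ⟨subset_erase.2 ⟨(subset_insert _ _).trans this.1, hs.2⟩, by omega⟩
  · intro s hs
    rw [mem_nonMemberSubfamily] at hs
    exact ⟨subset_erase.2 ⟨(hF _ hs.1).1, hs.2⟩, (hF _ hs.1).2⟩
  · intro s hs t ht
    rw [mem_memberSubfamily] at hs
    rw [mem_nonMemberSubfamily] at ht
    exact inter_nonempty_of_insert ht.2 (hint _ hs.1 _ ht.1)

/-- Splitting an intersecting family by two vertices which separate enough members. -/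
lemma card_le_of_separated {n k x y : ℕ} {F : Finset (Finset ℕ)} (hn : 2 * k < n) (hk : 3 ≤ k)
    (hF : ∀ A ∈ F, A ⊆ Icc 1 n ∧ #A = k)
    (hint : ∀ A ∈ F, ∀ B ∈ F, (A ∩ B).Nonempty) (hx : x ∈ Icc 1 n) (hy : y ∈ Icc 1 n)
    (hxy : x ≠ y)
    (h₁ : (n - 4).choose (k - 3) ≤ #((F.memberSubfamily x).nonMemberSubfamily y))
    (h₂ : (n - 4).choose (k - 3) ≤ #((F.nonMemberSubfamily x).memberSubfamily y))
    (h₃ : #((F.memberSubfamily x).memberSubfamily y) +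
      #((F.nonMemberSubfamily x).nonMemberSubfamily y) ≤ (n - 2).choose (k - 2)) :
    #F ≤ (n - 2).choose (k - 2) + 2 * (n - 3).choose (k - 2) := by
  have hX : #(((Icc 1 n).erase x).erase y) = n - 2 := by
    rw [card_erase_of_mem (mem_erase.2 ⟨hxy.symm, hy⟩), card_erase_of_mem hx]; simp; omega
  have h := card_add_card_le_two_mul_choose (r := k - 1) (N := n - 2)
    (A := (F.memberSubfamily x).nonMemberSubfamily y)
    (B := (F.nonMemberSubfamily x).memberSubfamily y) (by omega) hX (by omega) ?_ ?_ ?_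
    (by rwa [show n - 2 - 2 = n - 4 by omega, show k - 1 - 2 = k - 3 by omega])
    (by rwa [show n - 2 - 2 = n - 4 by omega, show k - 1 - 2 = k - 3 by omega])
  · have c1 := card_memberSubfamily_add_card_nonMemberSubfamily x F
    have c2 := card_memberSubfamily_add_card_nonMemberSubfamily y (F.memberSubfamily x)
    have c3 := card_memberSubfamily_add_card_nonMemberSubfamily y (F.nonMemberSubfamily x)
    rw [show n - 2 - 1 = n - 3 by omega, show k - 1 - 1 = k - 2 by omega] at h
    omega
  · intro s hs
    rw [mem_nonMemberSubfamily, mem_memberSubfamily] at hs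
    have := hF _ hs.1.1
    rw [card_insert_of_notMem hs.1.2] at this
    exact ⟨subset_erase.2 ⟨subset_erase.2 ⟨(subset_insert _ _).trans this.1, hs.1.2⟩, hs.2⟩,
      by omega⟩
  · intro s hs
    rw [mem_memberSubfamily, mem_nonMemberSubfamily] at hs
    have := hF _ hs.1.1
    rw [card_insert_of_notMem hs.2] at this
    exact ⟨subset_erase.2 ⟨subset_erase.2 ⟨(subset_insert _ _).trans this.1,
      fun h => hs.1.2 (mem_insert_of_mem h)⟩, hs.2⟩, by omega⟩
  · intro s hs t ht
    rw [mem_nonMemberSubfamily, mem_memberSubfamily] at hs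
    rw [mem_memberSubfamily, mem_nonMemberSubfamily] at ht
    have h := inter_nonempty_of_insert ht.1.2 (hint _ hs.1.1 _ ht.1.1)
    rw [inter_comm] at h ⊢
    exact inter_nonempty_of_insert hs.2 h

/-- A family is shifted above `p` if replacing an element of a member by a smaller one which is at
least `p` gives a member. -/
def IsShiftedFrom (p : ℕ) (F : Finset (Finset ℕ)) : Prop :=
  ∀ A ∈ F, ∀ x y, p ≤ x → x < y → y ∈ A → x ∉ A → insert x (A.erase y) ∈ F

lemma IsShiftedFrom.nonMemberSubfamily_top {p v : ℕ} {G : Finset (Finset ℕ)}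
    (h : IsShiftedFrom p G) (hG : ∀ A ∈ G, A ⊆ Ico p (v + 1)) :
    IsShiftedFrom p (G.nonMemberSubfamily v) := by
  intro A hA x y hpx hxy hy hx
  rw [mem_nonMemberSubfamily] at hA ⊢
  refine ⟨h A hA.1 x y hpx hxy hy hx, ?_⟩
  have := mem_Ico.1 (hG A hA.1 hy)
  rw [mem_insert, mem_erase]
  rintro (rfl | ⟨-, h⟩)
  · omega
  · exact hA.2 h

lemma IsShiftedFrom.memberSubfamily_top {p v : ℕ} {G : Finset (Finset ℕ)}
    (h : IsShiftedFrom p G) (hG : ∀ A ∈ G, A ⊆ Ico p (v + 1)) :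
    IsShiftedFrom p (G.memberSubfamily v) := by
  intro A hA x y hpx hxy hy hx
  rw [mem_memberSubfamily] at hA ⊢
  have hyv := mem_Ico.1 (hG _ hA.1 (mem_insert_of_mem hy))
  have hyv' : y ≠ v := by rintro rfl; exact hA.2 hy
  have := h _ hA.1 x y hpx hxy (mem_insert_of_mem hy) (by rw [mem_insert]; rintro (rfl | h) <;> grind)
  rw [erase_insert_of_ne hyv'.symm, insert_comm] at this
  refine ⟨this, ?_⟩
  rw [mem_insert, mem_erase]
  rintro (rfl | ⟨-, h⟩)
  · omega
  · exact hA.2 h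

lemma memberSubfamily_top_bounds {p v k : ℕ} {G : Finset (Finset ℕ)}
    (hG : ∀ A ∈ G, A ⊆ Ico p (v + 1) ∧ #A = k + 1) :
    ∀ A ∈ G.memberSubfamily v, A ⊆ Ico p v ∧ #A = k := by
  intro A hA
  rw [mem_memberSubfamily] at hA
  have := hG _ hA.1
  rw [card_insert_of_notMem hA.2] at this
  refine ⟨fun z hz => ?_, by omega⟩
  have h1 := mem_Ico.1 (this.1 (mem_insert_of_mem hz))
  have h2 : z ≠ v := by rintro rfl; exact hA.2 hz
  rw [mem_Ico]; omega

lemma nonMemberSubfamily_top_bounds {p v k : ℕ} {G : Finset (Finset ℕ)}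
    (hG : ∀ A ∈ G, A ⊆ Ico p (v + 1) ∧ #A = k) :
    ∀ A ∈ G.nonMemberSubfamily v, A ⊆ Ico p v ∧ #A = k := by
  intro A hA
  rw [mem_nonMemberSubfamily] at hA
  have := hG _ hA.1
  refine ⟨fun z hz => ?_, this.2⟩
  have h1 := mem_Ico.1 (this.1 hz)
  have h2 : z ≠ v := by rintro rfl; exact hA.2 hz
  rw [mem_Ico]; omega

lemma exists_mem_Ico_notMem_union {p N : ℕ} {A B : Finset ℕ} (h : #A + #B < N + #(A ∩ B)) :
    ∃ w ∈ Ico p (p + N), w ∉ A ∧ w ∉ B := by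
  have h1 := card_union_add_card_inter A B
  have h2 : #(A ∪ B) < #(Ico p (p + N)) := by rw [Nat.card_Ico]; omega
  obtain ⟨w, hw, hw'⟩ := exists_mem_notMem_of_card_lt_card h2
  rw [mem_union, not_or] at hw'
  exact ⟨w, hw, hw'⟩

lemma IsShiftedFrom.insert_mem_of_memberSubfamily {p v w : ℕ} {G : Finset (Finset ℕ)}
    {A : Finset ℕ} (h : IsShiftedFrom p G) (hA : A ∈ G.memberSubfamily v) (hw : w ∈ Ico p v)
    (hwA : w ∉ A) : insert w A ∈ G := by
  rw [mem_memberSubfamily] at hA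
  rw [mem_Ico] at hw
  have := h _ hA.1 w v hw.1 hw.2 (mem_insert_self _ _)
    (by rw [mem_insert]; rintro (rfl | h) <;> grind)
  rwa [erase_insert hA.2] at this

lemma le_card_inter_of_memberSubfamily {p N k t : ℕ} {G : Finset (Finset ℕ)}
    (h : IsShiftedFrom p G) (hG : ∀ A ∈ G, A ⊆ Ico p (p + N + 1) ∧ #A = k + 1)
    (ht : ∀ A ∈ G, ∀ B ∈ G, t ≤ #(A ∩ B)) (hN : 2 * k + 2 ≤ N + t) :
    ∀ A ∈ G.memberSubfamily (p + N), ∀ B ∈ G.memberSubfamily (p + N), t ≤ #(A ∩ B) := by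
  intro A hA B hB
  by_contra! hlt
  have hA' := memberSubfamily_top_bounds hG A hA
  have hB' := memberSubfamily_top_bounds hG B hB
  have hAm := mem_memberSubfamily.1 hA
  have hBm := mem_memberSubfamily.1 hB
  have h1 := ht _ hAm.1 _ hBm.1
  rw [← insert_inter_distrib, card_insert_of_notMem (by grind)] at h1
  obtain ⟨w, hw, hwA, hwB⟩ := exists_mem_Ico_notMem_union (p := p) (N := N) (A := A) (B := B)
    (by omega)
  have h2 := ht _ (h.insert_mem_of_memberSubfamily hA hw hwA) _ hBm.1
  have hwv : w ≠ p + N := by rw [mem_Ico] at hw; omega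
  rw [insert_inter_of_notMem (by grind), inter_insert_of_notMem hAm.2] at h2
  omega

/-- The shadow of a shifted intersecting family is at least as large as the family. -/
lemma IsShiftedFrom.card_le_card_shadow {p N k : ℕ} {G : Finset (Finset ℕ)}
    (h : IsShiftedFrom p G) (hG : ∀ A ∈ G, A ⊆ Ico p (p + N) ∧ #A = k)
    (hint : ∀ A ∈ G, ∀ B ∈ G, 1 ≤ #(A ∩ B)) : #G ≤ #(∂ G) := by
  induction N generalizing k G with
  | zero =>
    rw [card_eq_zero.2 (eq_empty_of_forall_notMem fun A hA => ?_)]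
    · exact Nat.zero_le _
    · have h1 := (hG A hA).1
      have h2 := hint A hA A hA
      rw [add_zero, Ico_self, subset_empty] at h1
      simp [h1] at h2
  | succ N ih =>
    obtain rfl | ⟨A₀, hA₀⟩ := G.eq_empty_or_nonempty
    · simp
    have hk : 1 ≤ k := by
      have := hint A₀ hA₀ A₀ hA₀
      rwa [inter_self, (hG A₀ hA₀).2] at this
    obtain ⟨k, rfl⟩ := Nat.exists_eq_add_of_le' hk
    by_cases hN : 2 * k + 1 ≤ N
    · have ih0 := ih (h.nonMemberSubfamily_top (v := p + N) fun A hA => (hG A hA).1)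
        (nonMemberSubfamily_top_bounds hG) (fun A hA B hB => by
          rw [mem_nonMemberSubfamily] at hA hB
          exact hint A hA.1 B hB.1)
      have ih1 := ih (h.memberSubfamily_top (v := p + N) fun A hA => (hG A hA).1)
        (memberSubfamily_top_bounds hG) (le_card_inter_of_memberSubfamily h hG hint (by omega))
      have c1 := card_memberSubfamily_add_card_nonMemberSubfamily (p + N) G
      have c2 := card_memberSubfamily_add_card_nonMemberSubfamily (p + N) (∂ G)
      have s0 : ∂ (G.nonMemberSubfamily (p + N)) ⊆ (∂ G).nonMemberSubfamily (p + N) := by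
        intro s hs
        obtain ⟨t, ht, a, ha, rfl⟩ := mem_shadow_iff.1 hs
        rw [mem_nonMemberSubfamily] at ht ⊢
        exact ⟨erase_mem_shadow ht.1 ha, fun h => ht.2 (mem_of_mem_erase h)⟩
      have s1 : ∂ (G.memberSubfamily (p + N)) ⊆ (∂ G).memberSubfamily (p + N) := by
        intro s hs
        obtain ⟨t, ht, a, ha, rfl⟩ := mem_shadow_iff.1 hs
        rw [mem_memberSubfamily] at ht ⊢
        refine ⟨?_, fun h => ht.2 (mem_of_mem_erase h)⟩
        have hne : p + N ≠ a := by rintro rfl; exact ht.2 ha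
        rw [← erase_insert_of_ne hne]
        exact erase_mem_shadow ht.1 (mem_insert_of_mem ha)
      have := card_le_card s0
      have := card_le_card s1
      omega
    · have hm := card_mul_choose_le_card_mul_choose (S := ∂ G) (a := k) (by omega) hG
        (fun t ht s hst hs => mem_shadow_iff_exists_mem_card_add_one.2
          ⟨t, ht, hst, by rw [(hG t ht).2, hs]⟩)
      rw [Nat.card_Ico, Nat.add_sub_cancel_left] at hm
      have hle : k + 1 ≤ N + 1 := by
        have := card_le_card (hG A₀ hA₀).1
        rwa [(hG A₀ hA₀).2, Nat.card_Ico, Nat.add_sub_cancel_left] at this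
      have hpos : 0 < (N + 1).choose k := Nat.choose_pos (by omega)
      have hc : (N + 1).choose (k + 1) ≤ (N + 1).choose k :=
        choose_le_choose_of_le_add (by omega) (by omega)
      exact Nat.le_of_mul_le_mul_right (hm.trans (Nat.mul_le_mul_left _ hc)) hpos

/-- Cross-intersecting families of `(j + 2)`-sets and `j`-sets, the former being shifted and
`3`-intersecting. -/
lemma IsShiftedFrom.card_add_card_le_choose {p N j : ℕ} {G H : Finset (Finset ℕ)}
    (h : IsShiftedFrom p G) (hG : ∀ A ∈ G, A ⊆ Ico p (p + N) ∧ #A = j + 2)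
    (hH : ∀ A ∈ H, A ⊆ Ico p (p + N) ∧ #A = j) (hint : ∀ A ∈ G, ∀ B ∈ G, 3 ≤ #(A ∩ B))
    (hGH : ∀ A ∈ G, ∀ B ∈ H, (A ∩ B).Nonempty) (hN : 2 * j + 2 ≤ N) :
    #G + #H ≤ N.choose j := by
  induction N generalizing j G H with
  | zero => omega
  | succ N ih =>
    have hHcard : #H ≤ (N + 1).choose j := by
      have : #(powersetCard j (Ico p (p + (N + 1)))) = (N + 1).choose j := by
        rw [card_powersetCard, Nat.card_Ico, Nat.add_sub_cancel_left]
      rw [← this]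
      exact card_le_card fun s hs => mem_powersetCard.2 (hH s hs)
    obtain rfl | ⟨A₀, hA₀⟩ := G.eq_empty_or_nonempty
    · simpa using hHcard
    have hj : 1 ≤ j := by
      have := hint A₀ hA₀ A₀ hA₀
      rw [inter_self, (hG A₀ hA₀).2] at this
      omega
    obtain ⟨j, rfl⟩ := Nat.exists_eq_add_of_le' hj
    obtain hN' | hN' := hN.eq_or_lt
    · have hcompl : ∀ A ∈ G, #(Ico p (p + (N + 1)) \ A) = j + 1 := by
        intro A hA
        rw [card_sdiff_of_subset (hG A hA).1, (hG A hA).2, Nat.card_Ico]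
        omega
      have hcard : #(G.image fun A => Ico p (p + (N + 1)) \ A) = #G := by
        refine card_image_of_injOn fun A hA B hB hAB => ?_
        rw [← Finset.sdiff_sdiff_eq_self (hG A hA).1, ← Finset.sdiff_sdiff_eq_self (hG B hB).1]
        exact congrArg (Ico p (p + (N + 1)) \ ·) hAB
      have hdisj : Disjoint (G.image fun A => Ico p (p + (N + 1)) \ A) H := by
        rw [disjoint_left]
        simp only [forall_mem_image]
        intro A hA hAH
        obtain ⟨v, hv⟩ := hGH A hA _ hAH
        simp at hv
      rw [← hcard, ← card_union_of_disjoint hdisj]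
      have : #(powersetCard (j + 1) (Ico p (p + (N + 1)))) = (N + 1).choose (j + 1) := by
        rw [card_powersetCard, Nat.card_Ico, Nat.add_sub_cancel_left]
      rw [← this]
      refine card_le_card (union_subset ?_ fun s hs => mem_powersetCard.2 (hH s hs))
      simp only [image_subset_iff]
      exact fun A hA => mem_powersetCard.2 ⟨sdiff_subset, hcompl A hA⟩
    · have ih0 := ih (h.nonMemberSubfamily_top (v := p + N) fun A hA => (hG A hA).1)
        (nonMemberSubfamily_top_bounds hG) (nonMemberSubfamily_top_bounds hH)
        (fun A hA B hB => by
          rw [mem_nonMemberSubfamily] at hA hB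
          exact hint A hA.1 B hB.1)
        (fun A hA B hB => by
          rw [mem_nonMemberSubfamily] at hA hB
          exact hGH A hA.1 B hB.1) (by omega)
      have ih1 := ih (h.memberSubfamily_top (v := p + N) fun A hA => (hG A hA).1)
        (memberSubfamily_top_bounds hG) (memberSubfamily_top_bounds hH)
        (le_card_inter_of_memberSubfamily h hG hint (by omega))
        (fun A hA B hB => by
          by_contra hAB
          rw [not_nonempty_iff_eq_empty] at hAB
          have hA' := memberSubfamily_top_bounds hG A hA
          have hB' := memberSubfamily_top_bounds hH B hB
          obtain ⟨w, hw, hwA, hwB⟩ := exists_mem_Ico_notMem_union (p := p) (N := N) (A := A)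
            (B := B) (by omega)
          have hAm := mem_memberSubfamily.1 hA
          have hBm := mem_memberSubfamily.1 hB
          obtain ⟨z, hz⟩ := hGH _ (h.insert_mem_of_memberSubfamily hA hw hwA) _ hBm.1
          have hwv : w ≠ p + N := by rw [mem_Ico] at hw; omega
          have : z ∈ A ∩ B := by grind
          simp [hAB] at this) (by omega)
      have c1 := card_memberSubfamily_add_card_nonMemberSubfamily (p + N) G
      have c2 := card_memberSubfamily_add_card_nonMemberSubfamily (p + N) H
      rw [Nat.choose_succ_succ]
      change _ ≤ N.choose j + N.choose (j + 1)
      omega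

/-- Shifted intersecting families missing the least vertex often. -/
lemma IsShiftedFrom.card_le {n k : ℕ} {F : Finset (Finset ℕ)} (hS : IsShiftedFrom 1 F)
    (hn : 2 * k < n) (hk : 3 ≤ k) (hF : ∀ A ∈ F, A ⊆ Icc 1 n ∧ #A = k)
    (hint : ∀ A ∈ F, ∀ B ∈ F, (A ∩ B).Nonempty)
    (hdiv : (n - 3).choose (k - 2) ≤ #(F.nonMemberSubfamily 1)) :
    #F ≤ (n - 2).choose (k - 2) + 2 * (n - 3).choose (k - 2) := by
  set G := (F.nonMemberSubfamily 1).nonMemberSubfamily 2 with hGdef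
  have hmemG : ∀ A, A ∈ G ↔ A ∈ F ∧ 1 ∉ A ∧ 2 ∉ A := fun A => by
    simp only [hGdef, mem_nonMemberSubfamily, and_assoc]
  have hGb : ∀ A ∈ G, A ⊆ Ico 3 (3 + (n - 2)) ∧ #A = k := by
    intro A hA
    rw [hmemG] at hA
    refine ⟨fun z hz => ?_, (hF A hA.1).2⟩
    have h0 := mem_Icc.1 ((hF A hA.1).1 hz)
    have h1 : z ≠ 1 := by rintro rfl; exact hA.2.1 hz
    have h2 : z ≠ 2 := by rintro rfl; exact hA.2.2 hz
    rw [mem_Ico]; omega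
  have hGS : IsShiftedFrom 3 G := by
    intro A hA x y hx hxy hy hxA
    rw [hmemG] at hA ⊢
    refine ⟨hS A hA.1 x y (by omega) hxy hy hxA, ?_, ?_⟩
    · rw [mem_insert, mem_erase]
      rintro (h | h)
      · omega
      · exact hA.2.1 h.2
    · rw [mem_insert, mem_erase]
      rintro (h | h)
      · omega
      · exact hA.2.2 h.2
  have hG3 : ∀ A ∈ G, ∀ B ∈ G, 3 ≤ #(A ∩ B) := by
    intro A hA B hB
    by_contra! hlt
    have hge3 : ∀ z ∈ A ∩ B, 3 ≤ z := fun z hz =>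
      (mem_Ico.1 ((hGb A hA).1 (mem_inter.1 hz).1)).1
    rw [hmemG] at hA hB
    obtain ⟨v, hv⟩ := hint A hA.1 B hB.1
    have hv3 := hge3 v hv
    have hA₁ := hS A hA.1 1 v le_rfl (by omega) (mem_inter.1 hv).1 hA.2.1
    obtain ⟨w, hw⟩ := hint _ hA₁ B hB.1
    have hw' : w ∈ (A ∩ B).erase v := by grind
    have hw3 := hge3 w (mem_of_mem_erase hw')
    have hB₁ := hS B hB.1 2 w (by omega) (by omega) (mem_inter.1 hw).2 hB.2.2
    obtain ⟨z, hz⟩ := hint _ hA₁ _ hB₁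
    have hz' : z ∈ ((A ∩ B).erase v).erase w := by grind
    have h1 := card_pos.2 ⟨z, hz'⟩
    rw [card_erase_of_mem hw', card_erase_of_mem hv] at h1
    omega
  have hshadow : ∂ G ⊆ (F.nonMemberSubfamily 1).memberSubfamily 2 := by
    intro t ht
    obtain ⟨A, hA, a, ha, rfl⟩ := mem_shadow_iff.1 ht
    have ha3 := (mem_Ico.1 ((hGb A hA).1 ha)).1
    rw [hmemG] at hA
    rw [mem_memberSubfamily, mem_nonMemberSubfamily]
    exact ⟨⟨hS A hA.1 2 a (by omega) (by omega) ha hA.2.2, by grind⟩, by grind⟩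
  have hle₁ : #G ≤ #((F.nonMemberSubfamily 1).memberSubfamily 2) :=
    (hGS.card_le_card_shadow hGb fun A hA B hB => by have := hG3 A hA B hB; omega).trans
      (card_le_card hshadow)
  have hle₂ : #((F.nonMemberSubfamily 1).memberSubfamily 2) ≤
      #((F.memberSubfamily 1).nonMemberSubfamily 2) := by
    refine card_le_card fun t ht => ?_
    rw [mem_memberSubfamily, mem_nonMemberSubfamily] at ht
    rw [mem_nonMemberSubfamily, mem_memberSubfamily]
    have := hS _ ht.1.1 1 2 le_rfl (by omega) (mem_insert_self _ _) ht.1.2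
    rw [erase_insert ht.2] at this
    exact ⟨⟨this, fun h => ht.1.2 (mem_insert_of_mem h)⟩, ht.2⟩
  have c := card_memberSubfamily_add_card_nonMemberSubfamily 2 (F.nonMemberSubfamily 1)
  rw [← hGdef] at c
  have p1 : (n - 3).choose (k - 2) = (n - 4).choose (k - 3) + (n - 4).choose (k - 2) := by
    rw [show n - 3 = n - 4 + 1 by omega, show k - 2 = k - 3 + 1 by omega]
    exact Nat.choose_succ_succ _ _
  have p2 : (n - 4).choose (k - 3) ≤ (n - 4).choose (k - 2) :=
    choose_le_choose_of_add_le (by omega) (by omega)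
  refine card_le_of_separated hn hk hF hint (x := 1) (y := 2) (by simp; omega) (by simp; omega)
    (by omega) (by omega) (by omega) ?_
  rw [← hGdef, add_comm]
  refine hGS.card_add_card_le_choose (by rwa [show k - 2 + 2 = k by omega]) ?_ hG3 ?_ (by omega)
  · intro A hA
    rw [mem_memberSubfamily, mem_memberSubfamily] at hA
    have := hF _ hA.1.1
    rw [card_insert_of_notMem hA.1.2, card_insert_of_notMem hA.2] at this
    refine ⟨fun z hz => ?_, by omega⟩
    have h0 := mem_Icc.1 (this.1 (mem_insert_of_mem (mem_insert_of_mem hz)))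
    have h1 : z ≠ 1 := by rintro rfl; exact hA.1.2 (mem_insert_of_mem hz)
    have h2 : z ≠ 2 := by rintro rfl; exact hA.2 hz
    rw [mem_Ico]; omega
  · intro A hA B hB
    rw [hmemG] at hA
    rw [mem_memberSubfamily, mem_memberSubfamily] at hB
    have h := hint _ hB.1.1 _ hA.1
    rw [inter_comm]
    exact inter_nonempty_of_insert hA.2.2 (inter_nonempty_of_insert hA.2.1 h)

lemma compress_singleton {x y : ℕ} (hxy : x ≠ y) (A : Finset ℕ) :
    UV.compress {x} {y} A = if x ∉ A ∧ y ∈ A then insert x (A.erase y) else A := by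
  unfold UV.compress
  simp only [disjoint_singleton_left, singleton_subset_iff]
  split_ifs
  · ext z
    simp only [sup_eq_union, mem_sdiff, mem_union, mem_singleton, mem_insert, mem_erase]
    grind
  · rfl

lemma inter_nonempty_of_mem_compression {x y : ℕ} {F : Finset (Finset ℕ)} (hxy : x ≠ y)
    (hint : ∀ A ∈ F, ∀ B ∈ F, (A ∩ B).Nonempty) :
    ∀ A ∈ UV.compression {x} {y} F, ∀ B ∈ UV.compression {x} {y} F, (A ∩ B).Nonempty := by
  have key : ∀ A ∈ F, UV.compress {x} {y} A ∈ F → ∀ C ∈ F, UV.compress {x} {y} C ∉ F →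
      (A ∩ UV.compress {x} {y} C).Nonempty := by
    intro A hA hA' C hC hC'
    simp only [compress_singleton hxy] at *
    split_ifs at hC' with hxC
    · rw [if_pos hxC]
      split_ifs at hA' with hxA
      · obtain ⟨v, hv⟩ := hint _ hA' _ hC
        exact ⟨v, by grind⟩
      · by_cases hx : x ∈ A
        · exact ⟨x, by grind⟩
        · obtain ⟨v, hv⟩ := hint _ hA _ hC
          exact ⟨v, by grind⟩
    · exact absurd hC hC'
  have hmem : ∀ C ∈ F, UV.compress {x} {y} C ∉ F → x ∈ UV.compress {x} {y} C := by
    intro C hC hC'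
    rw [compress_singleton hxy] at hC' ⊢
    split_ifs at hC' ⊢
    · exact mem_insert_self _ _
    · exact absurd hC hC'
  intro A hA B hB
  rw [UV.mem_compression] at hA hB
  obtain ⟨hA, hA'⟩ | ⟨hA, C, hC, rfl⟩ := hA <;> obtain ⟨hB, hB'⟩ | ⟨hB, D, hD, rfl⟩ := hB
  · exact hint A hA B hB
  · exact key A hA hA' D hD hB
  · rw [inter_comm]
    exact key B hB hB' C hC hA
  · exact ⟨x, mem_inter.2 ⟨hmem C hC hA, hmem D hD hB⟩⟩

lemma card_nonMemberSubfamily_le_compression {x y z : ℕ} (F : Finset (Finset ℕ)) (hxy : x ≠ y)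
    (hzx : z ≠ x) :
    #(F.nonMemberSubfamily z) ≤ #((UV.compression {x} {y} F).nonMemberSubfamily z) := by
  rw [← UV.card_compression {x} {y} (F.nonMemberSubfamily z)]
  refine card_le_card fun A hA => ?_
  rw [UV.mem_compression] at hA
  simp only [mem_nonMemberSubfamily, UV.mem_compression] at hA ⊢
  obtain ⟨hA, hA'⟩ | ⟨hA, B, hB, rfl⟩ := hA
  · exact ⟨Or.inl ⟨hA.1, hA'.1⟩, hA.2⟩
  · have hz : z ∉ UV.compress {x} {y} B := by
      rw [compress_singleton hxy]
      split_ifs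
      · grind
      · exact hB.2
    exact ⟨Or.inr ⟨fun h => hA ⟨h, hz⟩, B, hB.1, rfl⟩, hz⟩

lemma sum_compression_lt {x y : ℕ} {F : Finset (Finset ℕ)} (hxy : x < y) {A₀ : Finset ℕ}
    (hA₀ : A₀ ∈ F) (hA₀' : UV.compress {x} {y} A₀ ∉ F) :
    ∑ A ∈ UV.compression {x} {y} F, ∑ a ∈ A, a < ∑ A ∈ F, ∑ a ∈ A, a := by
  set φ : Finset ℕ → Finset ℕ :=
    fun A => if UV.compress {x} {y} A ∈ F then A else UV.compress {x} {y} A with hφ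
  have himg : UV.compression {x} {y} F = F.image φ := by
    ext A
    rw [UV.mem_compression, mem_image]
    constructor
    · rintro (⟨h, h'⟩ | ⟨h, B, hB, rfl⟩)
      · exact ⟨A, h, by simp only [hφ, if_pos h']⟩
      · exact ⟨B, hB, by simp only [hφ, if_neg h]⟩
    · rintro ⟨B, hB, rfl⟩
      by_cases h : UV.compress {x} {y} B ∈ F
      · left
        simp only [hφ, if_pos h]
        exact ⟨hB, h⟩
      · right
        simp only [hφ, if_neg h]
        exact ⟨h, B, hB, rfl⟩
  have hinj : Set.InjOn φ F := by
    rw [← card_image_iff, ← himg, UV.card_compression]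
  have hlt : ∀ A ∈ F, UV.compress {x} {y} A ∉ F → ∑ a ∈ φ A, a < ∑ a ∈ A, a := by
    intro A hA hA'
    simp only [hφ, if_neg hA']
    rw [compress_singleton hxy.ne] at hA' ⊢
    split_ifs at hA' ⊢ with h
    · rw [sum_insert (by grind), ← add_sum_erase A (fun a => a) h.2]
      omega
    · exact absurd hA hA'
  rw [himg, sum_image hinj]
  refine sum_lt_sum (fun A hA => ?_) ⟨A₀, hA₀, hlt A₀ hA₀ hA₀'⟩
  by_cases h : UV.compress {x} {y} A ∈ F
  · simp only [hφ, if_pos h, le_refl]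
  · exact (hlt A hA h).le

/-- The case of the compression making some vertex too popular. -/
lemma card_le_of_compression {n k x y : ℕ} {F : Finset (Finset ℕ)} (hn : 2 * k < n) (hk : 3 ≤ k)
    (hx : x ∈ Icc 1 n) (hy : y ∈ Icc 1 n) (hxy : x ≠ y)
    (hF : ∀ A ∈ F, A ⊆ Icc 1 n ∧ #A = k) (hint : ∀ A ∈ F, ∀ B ∈ F, (A ∩ B).Nonempty)
    (hdiv : ∀ z ∈ Icc 1 n, (n - 3).choose (k - 2) ≤ #(F.nonMemberSubfamily z))
    (hG : #((F.nonMemberSubfamily x).nonMemberSubfamily y) ≤ (n - 4).choose (k - 3)) :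
    #F ≤ (n - 2).choose (k - 2) + 2 * (n - 3).choose (k - 2) := by
  have p1 : (n - 3).choose (k - 2) = (n - 4).choose (k - 3) + (n - 4).choose (k - 2) := by
    rw [show n - 3 = n - 4 + 1 by omega, show k - 2 = k - 3 + 1 by omega]
    exact Nat.choose_succ_succ _ _
  have p2 : (n - 4).choose (k - 3) ≤ (n - 4).choose (k - 2) :=
    choose_le_choose_of_add_le (by omega) (by omega)
  have hcomm : (F.nonMemberSubfamily y).nonMemberSubfamily x =
      (F.nonMemberSubfamily x).nonMemberSubfamily y := by
    ext A; simp only [mem_nonMemberSubfamily]; tauto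
  have hcomm' : (F.nonMemberSubfamily y).memberSubfamily x =
      (F.memberSubfamily x).nonMemberSubfamily y := by
    ext A; simp only [mem_nonMemberSubfamily, mem_memberSubfamily]; grind
  have c1 := card_memberSubfamily_add_card_nonMemberSubfamily y (F.nonMemberSubfamily x)
  have c2 := card_memberSubfamily_add_card_nonMemberSubfamily x (F.nonMemberSubfamily y)
  have d1 := hdiv x hx
  have d2 := hdiv y hy
  rw [hcomm, hcomm'] at c2
  have hX : #(((Icc 1 n).erase x).erase y) = n - 2 := by
    rw [card_erase_of_mem (mem_erase.2 ⟨hxy.symm, hy⟩), card_erase_of_mem hx]; simp; omega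
  refine card_le_of_separated hn hk hF hint hx hy hxy (by omega) (by omega) ?_
  refine card_add_card_le_choose (by omega) hX (by omega) ?_ ?_ ?_
    (by rw [show n - 2 - 2 = n - 4 by omega]; omega)
  · intro A hA
    rw [mem_memberSubfamily, mem_memberSubfamily] at hA
    have := hF _ hA.1.1
    rw [card_insert_of_notMem hA.1.2, card_insert_of_notMem hA.2] at this
    exact ⟨subset_erase.2 ⟨subset_erase.2
      ⟨(subset_insert _ _).trans ((subset_insert _ _).trans this.1),
      fun h => hA.1.2 (mem_insert_of_mem h)⟩, hA.2⟩, by omega⟩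
  · intro A hA
    rw [mem_nonMemberSubfamily, mem_nonMemberSubfamily] at hA
    have := hF _ hA.1.1
    exact ⟨subset_erase.2 ⟨subset_erase.2 ⟨this.1, hA.1.2⟩, hA.2⟩, by omega⟩
  · intro A hA B hB
    rw [mem_memberSubfamily, mem_memberSubfamily] at hA
    rw [mem_nonMemberSubfamily, mem_nonMemberSubfamily] at hB
    exact inter_nonempty_of_insert hB.2
      (inter_nonempty_of_insert hB.1.2 (hint _ hA.1.1 _ hB.1.1))

/-- Intersecting families all of whose vertices are missed by many members. -/
lemma card_le_of_le_card_nonMemberSubfamily {n k : ℕ} (hn : 2 * k < n) (hk : 3 ≤ k)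
    (F : Finset (Finset ℕ)) (hF : ∀ A ∈ F, A ⊆ Icc 1 n ∧ #A = k)
    (hint : ∀ A ∈ F, ∀ B ∈ F, (A ∩ B).Nonempty)
    (hdiv : ∀ z ∈ Icc 1 n, (n - 3).choose (k - 2) ≤ #(F.nonMemberSubfamily z)) :
    #F ≤ (n - 2).choose (k - 2) + 2 * (n - 3).choose (k - 2) := by
  induction hw : ∑ A ∈ F, ∑ a ∈ A, a using Nat.strong_induction_on generalizing F with
  | _ w ih =>
    subst hw
    by_cases hS : IsShiftedFrom 1 F
    · exact hS.card_le hn hk hF hint (hdiv 1 (by simp; omega))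
    · unfold IsShiftedFrom at hS
      push Not at hS
      obtain ⟨A₀, hA₀, x, y, hx1, hxy, hyA, hxA, hnot⟩ := hS
      have hy : y ∈ Icc 1 n := (hF A₀ hA₀).1 hyA
      have hx : x ∈ Icc 1 n := by rw [mem_Icc] at hy ⊢; omega
      have hA₀' : UV.compress {x} {y} A₀ ∉ F := by
        rwa [compress_singleton hxy.ne, if_pos ⟨hxA, hyA⟩]
      have hF' : ∀ A ∈ UV.compression {x} {y} F, A ⊆ Icc 1 n ∧ #A = k := by
        intro A hA
        rw [UV.mem_compression] at hA
        obtain ⟨hA, -⟩ | ⟨-, B, hB, rfl⟩ := hA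
        · exact hF A hA
        · refine ⟨?_, by rw [UV.card_compress (by simp)]; exact (hF B hB).2⟩
          rw [compress_singleton hxy.ne]
          split_ifs
          · exact insert_subset hx ((erase_subset _ _).trans (hF B hB).1)
          · exact (hF B hB).1
      have hint' := inter_nonempty_of_mem_compression hxy.ne hint
      have hcard := UV.card_compression {x} {y} F
      by_cases hx' : (n - 3).choose (k - 2) ≤
          #((UV.compression {x} {y} F).nonMemberSubfamily x)
      · rw [← hcard]
        refine ih _ (sum_compression_lt hxy hA₀ hA₀') _ hF' hint' (fun z hz => ?_) rfl
        by_cases hzx : z = x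
        · rwa [hzx]
        · exact (hdiv z hz).trans (card_nonMemberSubfamily_le_compression F hxy.ne hzx)
      · by_cases hx4 : (n - 4).choose (k - 3) ≤
            #((UV.compression {x} {y} F).nonMemberSubfamily x)
        · have h := card_add_choose_le hn le_rfl (by omega) hF' hint' hx
            (by rwa [show k + 1 - 4 = k - 3 by omega]) (by omega)
          rw [hcard, show k + 1 - 4 = k - 3 by omega] at h
          have q1 : (n - 1).choose (k - 1) = (n - 2).choose (k - 2) + (n - 2).choose (k - 1) := by
            rw [show n - 1 = n - 2 + 1 by omega, show k - 1 = k - 2 + 1 by omega]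
            exact Nat.choose_succ_succ _ _
          have q2 : (n - 2).choose (k - 1) = (n - 3).choose (k - 2) + (n - 3).choose (k - 1) := by
            rw [show n - 2 = n - 3 + 1 by omega, show k - 1 = k - 2 + 1 by omega]
            exact Nat.choose_succ_succ _ _
          have q3 : (n - 3).choose (k - 1) = (n - 4).choose (k - 2) + (n - 4).choose (k - 1) := by
            rw [show n - 3 = n - 4 + 1 by omega, show k - 1 = k - 2 + 1 by omega]
            exact Nat.choose_succ_succ _ _
          have q4 : (n - 3).choose (k - 2) = (n - 4).choose (k - 3) + (n - 4).choose (k - 2) := by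
            rw [show n - 3 = n - 4 + 1 by omega, show k - 2 = k - 3 + 1 by omega]
            exact Nat.choose_succ_succ _ _
          omega
        · refine card_le_of_compression hn hk hx hy hxy.ne hF hint hdiv ?_
          refine le_trans (card_le_card fun A hA => ?_) (le_of_not_ge hx4)
          simp only [mem_nonMemberSubfamily] at hA ⊢
          refine ⟨UV.mem_compression.2 (Or.inl ⟨hA.1.1, ?_⟩), hA.1.2⟩
          rw [compress_singleton hxy.ne, if_neg fun h => hA.2 h.2]
          exact hA.1.1

lemma card_le_three_of_card_eq_two {n : ℕ} {F : Finset (Finset ℕ)}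
    (hF : ∀ A ∈ F, A ⊆ Icc 1 n ∧ #A = 2) (hint : ∀ A ∈ F, ∀ B ∈ F, (A ∩ B).Nonempty)
    (hdeg : ∀ v ∈ Icc 1 n, #{A ∈ F | v ∈ A} ≤ 2) : #F ≤ 3 := by
  obtain rfl | ⟨A, hA⟩ := F.eq_empty_or_nonempty
  · simp
  obtain ⟨hAn, hA2⟩ := hF A hA
  obtain ⟨x, y, hxy, rfl⟩ := card_eq_two.1 hA2
  have hx := hdeg x (hAn (by simp))
  have hy := hdeg y (hAn (by simp))
  have hxc := card_erase_of_mem (s := {B ∈ F | x ∈ B}) (a := {x, y}) (by simp [hA])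
  have hyc := card_erase_of_mem (s := {B ∈ F | y ∈ B}) (a := {x, y}) (by simp [hA])
  have hsub : F ⊆ insert {x, y} (({B ∈ F | x ∈ B}.erase {x, y}) ∪
      ({B ∈ F | y ∈ B}.erase {x, y})) := by
    intro B hB
    obtain ⟨v, hv⟩ := hint _ hA B hB
    simp only [mem_insert, mem_union, mem_erase, mem_filter]
    simp only [mem_inter, mem_insert, mem_singleton] at hv
    grind
  have h1 := card_le_card hsub
  have h2 := card_insert_le ({x, y} : Finset ℕ) (({B ∈ F | x ∈ B}.erase {x, y}) ∪
      ({B ∈ F | y ∈ B}.erase {x, y}))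
  have h3 := card_union_le ({B ∈ F | x ∈ B}.erase {x, y}) ({B ∈ F | y ∈ B}.erase {x, y})
  omega

lemma sum_choose_add_choose {n k i : ℕ} (hk : 2 ≤ k) (hi : 1 ≤ i) (hin : i ≤ n) :
    ∑ j ∈ Icc 2 i, (n - j).choose (k - 2) + (n - i).choose (k - 1) =
      (n - 1).choose (k - 1) := by
  induction i, hi using Nat.le_induction with
  | base => simp
  | succ i hi ih =>
    rw [sum_Icc_succ_top (by omega), ← ih (by omega), add_assoc]
    congr 1
    rw [show n - i = n - (i + 1) + 1 by omega, show k - 1 = k - 2 + 1 by omega]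
    exact (Nat.choose_succ_succ _ _).symm

lemma le_sum_choose_add_choose {n k i : ℕ} (hn : 2 * k < n) (hi3 : 3 ≤ i) (hik : i ≤ k + 1) :
    (n - 2).choose (k - 2) + 2 * (n - 3).choose (k - 2) ≤
      ∑ j ∈ Icc 2 i, (n - j).choose (k - 2) + (n - i).choose (k + 1 - i) := by
  induction i, hi3 using Nat.le_induction with
  | base =>
    rw [show Icc 2 3 = {2, 3} from rfl, sum_pair (by norm_num), show k + 1 - 3 = k - 2 by omega]
    omega
  | succ i hi ih =>
    refine (ih (by omega)).trans ?_
    rw [sum_Icc_succ_top (by omega)]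
    have p : (n - i).choose (k + 1 - i) =
        (n - (i + 1)).choose (k + 1 - (i + 1)) + (n - (i + 1)).choose (k + 1 - i) := by
      rw [show n - i = n - (i + 1) + 1 by omega,
        show k + 1 - i = k + 1 - (i + 1) + 1 by omega]
      exact Nat.choose_succ_succ _ _
    have q : (n - (i + 1)).choose (k + 1 - i) ≤ (n - (i + 1)).choose (k - 2) :=
      choose_le_choose_of_add_le (by omega) (by omega)
    omega

theorem Frankl_max_degree (n k i : ℕ) (hn : 2 * k < n) (hi3 : 3 ≤ i) (hik : i ≤ k + 1)
    (F : Finset (Finset ℕ))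
    (hF : ∀ A ∈ F, A ∈ (Finset.Icc 1 n).powersetCard k)
    (hint : ∀ A ∈ F, ∀ B ∈ F, (A ∩ B).Nonempty)
    (hdeg : ∀ v ∈ Finset.Icc 1 n,
      (F.filter (fun A => v ∈ A)).card ≤ ∑ j ∈ Finset.Icc 2 i, (n - j).choose (k - 2)) :
    F.card ≤ (∑ j ∈ Finset.Icc 2 i, (n - j).choose (k - 2)) + (n - i).choose (k + 1 - i) := by
  have hF' : ∀ A ∈ F, A ⊆ Icc 1 n ∧ #A = k := fun A hA => mem_powersetCard.1 (hF A hA)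
  obtain rfl | hk : k = 2 ∨ 3 ≤ k := by omega
  · obtain rfl : i = 3 := by omega
    simp only [show Icc 2 3 = {2, 3} from rfl, sum_pair (show 2 ≠ 3 by norm_num),
      Nat.choose_zero_right, show 2 + 1 - 3 = 0 from rfl] at hdeg ⊢
    exact card_le_three_of_card_eq_two hF' hint hdeg
  by_cases h₁ : ∃ x ∈ Icc 1 n, #(F.nonMemberSubfamily x) ≤ (n - i).choose (k + 1 - i)
  · obtain ⟨x, hx, hle⟩ := h₁
    rw [← card_filter_add_card_filter_not (s := F) (fun A => x ∈ A)]
    exact Nat.add_le_add (hdeg x hx) hle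
  push Not at h₁
  by_cases h₂ : ∃ x ∈ Icc 1 n, #(F.nonMemberSubfamily x) ≤ (n - 3).choose (k - 2)
  · obtain ⟨x, hx, hle⟩ := h₂
    have hlt := h₁ x hx
    have hi4 : 4 ≤ i := by
      by_contra h
      obtain rfl : i = 3 := by omega
      rw [show k + 1 - 3 = k - 2 by omega] at hlt
      omega
    have h := card_add_choose_le hn hi4 hik hF' hint hx hlt.le hle
    have hsum := sum_choose_add_choose (n := n) (k := k) (i := i) (by omega) (by omega) (by omega)
    omega
  · push Not at h₂
    exact (card_le_of_le_card_nonMemberSubfamily hn hk F hF' hint fun z hz => (h₂ z hz).le).trans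
      (le_sum_choose_add_choose hn hi3 hik)
end
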